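/- arXiv:0805.1673 — 2 statements merged into one kernel-verified Lean document; each statement's English description precedes it below -/
import Mathlib

section
/- (Weighted mixed-norm Strichartz for half-wave, interpolated) For $n \ge 2$, $2 \le q \le \infty$, and $1/2 - 1/q < \gamma < n/2 - 1/q$, there is a constant $C$ so that for all Schwartz $\varphi$: $\left( \int_0^\infty \int_0^\infty \left( \int_{S^{n-1}} |r^{n/2 - (n+1)/q - \gamma}(e^{it|D|}\varphi)(r\omega)|^2 d\sigma(\omega) \right)^{q/2} r^{n-1} dr\, dt \right)^{1/q} \le C \|\varphi\|_{\dot H^\gamma(\mathbb{R}^n)}$. -/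
open MeasureTheory Real Set FourierTransform
open scoped RealInnerProductSpace

noncomputable section

abbrev Euc (n : ℕ) := EuclideanSpace ℝ (Fin n)

/-- Fourier multiplier operator with symbol `m`. -/
def mulOp {n : ℕ} (m : Euc n → ℂ) (f : Euc n → ℂ) (x : Euc n) : ℂ :=
  ∫ ξ : Euc n, Complex.exp (2 * π * Complex.I * (⟪x, ξ⟫ : ℝ)) * m ξ * (𝓕 f ξ)

/-- Half-wave propagator `e^{it|D|}`. -/
def halfWave {n : ℕ} (t : ℝ) (f : Euc n → ℂ) : Euc n → ℂ :=
  mulOp (fun ξ => Complex.exp (Complex.I * t * ‖ξ‖)) f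

/-- Homogeneous Sobolev norm `‖f‖_{Ḣˢ}`. -/
def hSob (n : ℕ) (s : ℝ) (f : Euc n → ℂ) : ℝ :=
  (∫ ξ : Euc n, ‖ξ‖ ^ (2 * s) * ‖𝓕 f ξ‖ ^ 2) ^ (1/2 : ℝ)

/-- Inhomogeneous Sobolev norm `‖f‖_{Hˢ}`. -/
def iSob (n : ℕ) (s : ℝ) (f : Euc n → ℂ) : ℝ :=
  (∫ ξ : Euc n, (1 + ‖ξ‖ ^ 2) ^ s * ‖𝓕 f ξ‖ ^ 2) ^ (1/2 : ℝ)

/-- `L²` norm of `g` on the sphere of radius `r` (unit-sphere surface measure). -/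
def sphL2 {n : ℕ} (g : Euc n → ℂ) (r : ℝ) : ℝ :=
  (∫ ω : Metric.sphere (0 : Euc n) 1, ‖g (r • (ω : Euc n))‖ ^ 2
      ∂((volume : Measure (Euc n)).toSphere)) ^ (1/2 : ℝ)

open scoped ENNReal

/-- polar coordinates -/
lemma polar_lint (n : ℕ) (hn : 2 ≤ n) (F : Euc n → ℝ≥0∞) (hF : Measurable F) :
    ∫⁻ x, F x = ∫⁻ r in Ioi (0:ℝ), ENNReal.ofReal (r ^ (n - 1)) *
      ∫⁻ ω : Metric.sphere (0 : Euc n) 1, F (r • (ω : Euc n))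
        ∂((volume : Measure (Euc n)).toSphere) := by
  have h1 : ∫⁻ x, F x = ∫⁻ x : ({(0 : Euc n)}ᶜ : Set (Euc n)), F x
      ∂(Measure.comap (↑) (volume : Measure (Euc n))) := by
    rw [lintegral_subtype_comap (measurableSet_singleton _).compl]
    have : Nontrivial (Euc n) := by
      have : Nonempty (Fin n) := ⟨⟨0, by omega⟩⟩
      infer_instance
    rw [restrict_compl_singleton]
  have hmp := (volume : Measure (Euc n)).measurePreserving_homeomorphUnitSphereProd
  have h2 := hmp.lintegral_comp_emb (Homeomorph.measurableEmbedding _)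
    (fun p : (Metric.sphere (0 : Euc n) 1) × (Ioi (0:ℝ)) => F (p.2.1 • (p.1 : Euc n)))
  have h3 : ∀ x : ({(0 : Euc n)}ᶜ : Set (Euc n)),
      ((homeomorphUnitSphereProd (Euc n) x).2.1 • ((homeomorphUnitSphereProd (Euc n) x).1 : Euc n))
        = x := by
    intro x
    have hx : ‖(x : Euc n)‖ ≠ 0 := norm_ne_zero_iff.2 x.2
    simp [smul_smul, hx]
  simp only [h3] at h2
  have hm : Measurable (fun p : (Metric.sphere (0 : Euc n) 1) × (Ioi (0:ℝ)) =>
      F (p.2.1 • (p.1 : Euc n))) := by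
    apply hF.comp
    fun_prop
  rw [h1, h2, lintegral_prod_symm _ hm.aemeasurable, Measure.volumeIoiPow,
    lintegral_withDensity_eq_lintegral_mul _ (by fun_prop) hm.lintegral_prod_left']
  simp only [finrank_euclideanSpace, Fintype.card_fin, Pi.mul_apply]
  rw [lintegral_subtype_comap measurableSet_Ioi (fun a : ℝ => ENNReal.ofReal (a ^ (n-1)) *
    ∫⁻ ω : Metric.sphere (0 : Euc n) 1, F (a • (ω : Euc n))
        ∂((volume : Measure (Euc n)).toSphere))]

lemma lint_gauss (n : ℕ) {b : ℝ} (hb : 0 < b) (w : Euc n) :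
    ∫⁻ x : Euc n, ENNReal.ofReal (rexp (-b * ‖x - w‖ ^ 2)) = ENNReal.ofReal ((π / b) ^ ((n:ℝ) / 2)) := by
  rw [lintegral_sub_right_eq_self (fun x : Euc n => ENNReal.ofReal (rexp (-b * ‖x‖ ^ 2))) w]
  rw [← ofReal_integral_eq_lintegral_ofReal]
  · rw [GaussianFourier.integral_rexp_neg_mul_sq_norm hb]; simp
  · have := GaussianFourier.integrable_cexp_neg_mul_sq_norm_add (V := Euc n) (b := (b:ℂ)) (by simpa using hb) 0 0
    have := this.norm
    refine this.congr (Filter.Eventually.of_forall fun x => ?_)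
    simp [Complex.norm_exp, ← Complex.ofReal_pow]
  · exact Filter.Eventually.of_forall fun x => (Real.exp_pos _).le

lemma norm_sphere_ineq {n : ℕ} (x y : Euc n) (hx : ‖x‖ = 1) (hy : ‖y‖ = 1) (r s : ℝ) :
    ‖r • x - s • y‖ ^ 2 = (r - s) ^ 2 + r * s * ‖x - y‖ ^ 2 := by
  rw [norm_sub_sq_real, norm_sub_sq_real, norm_smul, norm_smul, inner_smul_left, inner_smul_right,
    hx, hy]
  simp
  ring

/-- Gaussian cap bound on the sphere -/
lemma sph_bound (n : ℕ) (hn : 2 ≤ n) : ∃ C : ℝ, 0 < C ∧ ∀ β : ℝ, 0 < β →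
    ∀ θ : Metric.sphere (0 : Euc n) 1, ∀ a : ℝ, 0 ≤ a → a ≤ ((n:ℝ)-1)/2 →
    ∫⁻ ω : Metric.sphere (0 : Euc n) 1, ENNReal.ofReal (rexp (-β * ‖(θ : Euc n) - ω‖ ^ 2))
        ∂((volume : Measure (Euc n)).toSphere) ≤ ENNReal.ofReal (C * β ^ (-a)) := by
  set σ := (volume : Measure (Euc n)).toSphere
  have hn' : (2:ℝ) ≤ n := by exact_mod_cast hn
  set C0 := σ.real univ
  have htriv : ∀ β : ℝ, 0 < β → ∀ θ : Metric.sphere (0 : Euc n) 1,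
    ∫⁻ ω : Metric.sphere (0 : Euc n) 1, ENNReal.ofReal (rexp (-β * ‖(θ : Euc n) - ω‖ ^ 2))
        ∂σ ≤ ENNReal.ofReal C0 := by
    intro β hβ θ
    calc _ ≤ ∫⁻ ω, 1 ∂σ := by
          refine lintegral_mono fun ω => ?_
          rw [ENNReal.ofReal_le_one, Real.exp_le_one_iff]
          have := sq_nonneg ‖(θ : Euc n) - ω‖
          nlinarith
      _ = _ := by simp [C0, Measure.real]
  have hC0 : 0 ≤ C0 := measureReal_nonneg
  have hbig : ∀ β : ℝ, 4 ≤ β → ∀ θ : Metric.sphere (0 : Euc n) 1,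
    ∫⁻ ω : Metric.sphere (0 : Euc n) 1, ENNReal.ofReal (rexp (-β * ‖(θ : Euc n) - ω‖ ^ 2))
        ∂σ ≤ ENNReal.ofReal ((2 ^ (n-1) * rexp 1 * π ^ ((n:ℝ)/2)) * β ^ (-(((n:ℝ)-1)/2))) := by
    intro β hβ θ
    have hβ0 : 0 < β := by linarith
    set J := ∫⁻ ω : Metric.sphere (0 : Euc n) 1, ENNReal.ofReal (rexp (-β * ‖(θ : Euc n) - ω‖ ^ 2)) ∂σ
    have hg := lint_gauss n hβ0 (θ : Euc n)
    rw [polar_lint n hn _ (by fun_prop)] at hg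
    have hs : 0 < β ^ (-(1/2):ℝ) := by positivity
    have hs2 : β ^ (-(1/2):ℝ) ≤ 1/2 := by
      rw [Real.rpow_neg hβ0.le, ← Real.sqrt_eq_rpow]
      rw [inv_le_comm₀ (by positivity) (by norm_num)]
      rw [Real.le_sqrt (by norm_num) hβ0.le]; norm_num; linarith
    have hs3 : β * (β ^ (-(1/2):ℝ)) ^ 2 = 1 := by
      rw [← Real.rpow_natCast, ← Real.rpow_mul hβ0.le]; norm_num
      rw [Real.rpow_neg_one]; field_simp
    set s := β ^ (-(1/2):ℝ) with hsdef
    have hlow : ENNReal.ofReal ((1/2)^(n-1) * rexp (-1) * s) * J ≤ ENNReal.ofReal ((π / β) ^ ((n:ℝ) / 2)) := by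
      rw [← hg]
      calc ENNReal.ofReal ((1/2)^(n-1) * rexp (-1) * s) * J
          = ∫⁻ r in Ioc (1 - s) 1, ENNReal.ofReal ((1/2)^(n-1) * rexp (-1)) * J := by
            rw [lintegral_const, Measure.restrict_apply_univ, Real.volume_Ioc]
            rw [ENNReal.ofReal_mul (by positivity)]
            have : 1 - (1 - s) = s := by ring
            rw [this]; ring
        _ ≤ ∫⁻ r in Ioc (1 - s) 1, ENNReal.ofReal (r ^ (n - 1)) *
              ∫⁻ ω : Metric.sphere (0 : Euc n) 1, ENNReal.ofReal (rexp (-β * ‖r • (ω : Euc n) - θ‖ ^ 2)) ∂σ := by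
            refine setLIntegral_mono' measurableSet_Ioc fun r hr => ?_
            have hr0 : 1/2 ≤ r := by linarith [hr.1]
            rw [ENNReal.ofReal_mul (by positivity), mul_assoc]
            gcongr
            rw [← lintegral_const_mul _ (by fun_prop)]
            refine lintegral_mono fun ω => ?_
            rw [← ENNReal.ofReal_mul (by positivity), ← Real.exp_add]
            gcongr
            have e1 := norm_sphere_ineq (ω : Euc n) (θ : Euc n) (by simp) (by simp) r 1
            rw [one_smul] at e1
            rw [e1, norm_sub_rev (θ : Euc n)]
            have e2 : (r - 1)^2 ≤ s ^ 2 := by nlinarith [hr.1, hr.2]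
            have e3 : β * (r-1)^2 ≤ 1 := (mul_le_mul_of_nonneg_left e2 hβ0.le).trans hs3.le
            have e4 : r * 1 * ‖(ω : Euc n) - θ‖ ^ 2 ≤ ‖(ω : Euc n) - θ‖ ^ 2 := by
              have := sq_nonneg ‖(ω : Euc n) - θ‖
              nlinarith [hr.2]
            nlinarith
        _ ≤ _ := lintegral_mono_set (fun r hr => by
              have := hr.1
              show 0 < r
              linarith)
    have hc : 0 < (1/2:ℝ)^(n-1) * rexp (-1) * s := by positivity
    rw [mul_comm, ← ENNReal.le_div_iff_mul_le (Or.inl (by simpa using hc)) (Or.inl ENNReal.ofReal_ne_top),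
      ← ENNReal.ofReal_div_of_pos hc] at hlow
    refine hlow.trans (le_of_eq ?_)
    congr 1
    rw [div_eq_iff hc.ne', Real.div_rpow pi_pos.le hβ0.le]
    have : β ^ (-(((n:ℝ)-1)/2)) * s = (β ^ ((n:ℝ)/2))⁻¹ := by
      rw [hsdef, ← Real.rpow_add hβ0, ← Real.rpow_neg hβ0.le]; congr 1; ring
    calc _ = π ^ ((n:ℝ)/2) * (β ^ (-(((n:ℝ)-1)/2)) * s) := by rw [this]; rfl
      _ = (2 ^ (n-1) * (1/2:ℝ)^(n-1)) * (rexp 1 * rexp (-1)) * π ^ ((n:ℝ)/2) * (β ^ (-(((n:ℝ)-1)/2)) * s) := by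
          rw [← mul_pow, ← Real.exp_add]; norm_num
      _ = _ := by ring
  set C1 := (2 ^ (n-1) * rexp 1 * π ^ ((n:ℝ)/2)) with hC1
  have hC1p : 0 < C1 := by positivity
  refine ⟨C0 * 4 ^ (((n:ℝ)-1)/2) + C1, by positivity, ?_⟩
  intro β hβ θ a ha ha2
  rcases le_total 4 β with h4 | h4
  · refine (hbig β h4 θ).trans ?_
    apply ENNReal.ofReal_le_ofReal
    have h5 : β ^ (-(((n:ℝ)-1)/2)) ≤ β ^ (-a) :=
      Real.rpow_le_rpow_of_exponent_le (by linarith) (by linarith)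
    calc C1 * β ^ (-(((n:ℝ)-1)/2)) ≤ C1 * β ^ (-a) := by gcongr
      _ ≤ _ := by
        gcongr
        have : 0 ≤ C0 * 4 ^ (((n:ℝ)-1)/2) := by positivity
        linarith
  · refine (htriv β hβ θ).trans ?_
    apply ENNReal.ofReal_le_ofReal
    have h5 : 1 ≤ (4:ℝ) ^ (((n:ℝ)-1)/2) * β ^ (-a) := by
      calc (1:ℝ) = 4 ^ a * 4 ^ (-a) := by rw [← Real.rpow_add (by norm_num)]; simp
        _ ≤ 4 ^ (((n:ℝ)-1)/2) * β ^ (-a) := by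
          apply mul_le_mul
          · exact Real.rpow_le_rpow_of_exponent_le (by norm_num) ha2
          · exact Real.rpow_le_rpow_of_nonpos hβ h4 (by linarith)
          · positivity
          · positivity
    have : 0 < β ^ (-a) := by positivity
    nlinarith


lemma ennreal_mul_le_sq (a b : ℝ≥0∞) : 2 * (a * b) ≤ a ^ 2 + b ^ 2 := by
  rcases eq_or_ne a ⊤ with rfl | ha
  · simp
  rcases eq_or_ne b ⊤ with rfl | hb
  · simp
  lift a to NNReal using ha
  lift b to NNReal using hb
  norm_cast
  have := two_mul_le_add_sq a b
  rw [← mul_assoc]; exact this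

/-- Schur-test form of the `T T^*` argument. -/
lemma schur_tt {X V : Type*} [MeasurableSpace X] [MeasurableSpace V] (μ : Measure X) [SFinite μ]
    (ν : Measure V) [SFinite ν] (w : V → ℝ) (hw0 : ∀ v, 0 ≤ w v) (hw : Integrable w ν)
    (e : V → X → ℂ) (he : Measurable (Function.uncurry e)) (he1 : ∀ v x, ‖e v x‖ ≤ 1)
    (g : X → ℂ) (hg : Integrable g μ) (K : X → X → ℝ≥0∞) (hK : Measurable (Function.uncurry K))
    (hKs : ∀ x y, K x y = K y x)
    (hKe : ∀ x y, ‖∫ v, (w v : ℂ) * e v x * (starRingEnd ℂ) (e v y) ∂ν‖ₑ ≤ K x y)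
    (M : ℝ≥0∞) (hM : ∀ᵐ x ∂μ, ∫⁻ y, K x y ∂μ ≤ M) :
    ∫⁻ v, ENNReal.ofReal (w v) * ‖∫ x, e v x * g x ∂μ‖ₑ ^ 2 ∂ν ≤ M * ∫⁻ x, ‖g x‖ₑ ^ 2 ∂μ := by
  set G : V → ℂ := fun v => ∫ x, e v x * g x ∂μ with hG
  have hint3 : Integrable (fun p : V × (X × X) =>
      ((w p.1 : ℂ)) * (e p.1 p.2.1 * g p.2.1) * (starRingEnd ℂ) (e p.1 p.2.2 * g p.2.2)) (ν.prod (μ.prod μ)) := by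
    have h1 : Integrable (fun p : V × (X × X) => ((w p.1 : ℂ)) * (g p.2.1 * (starRingEnd ℂ) (g p.2.2)))
        (ν.prod (μ.prod μ)) := by
      apply Integrable.mul_prod (f := fun v => (w v : ℂ)) (g := fun p : X × X => g p.1 * (starRingEnd ℂ) (g p.2))
      · exact hw.ofReal
      · apply Integrable.mul_prod (f := g) (g := fun x => (starRingEnd ℂ) (g x)) hg
        exact (Complex.conjLIE.toContinuousLinearEquiv.toContinuousLinearMap.integrable_comp hg)
    have h2 : AEStronglyMeasurable (fun p : V × (X × X) => e p.1 p.2.1 * (starRingEnd ℂ) (e p.1 p.2.2)) (ν.prod (μ.prod μ)) := by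
      apply Measurable.aestronglyMeasurable
      have m1 : Measurable fun p : V × (X × X) => e p.1 p.2.1 :=
        he.comp (by fun_prop : Measurable fun p : V × (X × X) => (p.1, p.2.1))
      have m2 : Measurable fun p : V × (X × X) => e p.1 p.2.2 :=
        he.comp (by fun_prop : Measurable fun p : V × (X × X) => (p.1, p.2.2))
      exact m1.mul (Complex.continuous_conj.measurable.comp m2)
    have h3 := h1.bdd_mul (c := 1) h2 (Filter.Eventually.of_forall fun p => by
      rw [norm_mul, RCLike.norm_conj]
      exact mul_le_one₀ (he1 _ _) (norm_nonneg _) (he1 _ _))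
    refine h3.congr (Filter.Eventually.of_forall fun p => ?_)
    simp only [map_mul]; ring
  have hGm : ∀ v, ∫ p : X × X, ((w v : ℂ)) * (e v p.1 * g p.1) * (starRingEnd ℂ) (e v p.2 * g p.2) ∂(μ.prod μ)
      = ((w v * ‖G v‖ ^ 2 : ℝ) : ℂ) := by
    intro v
    simp only [mul_assoc (w v : ℂ)]
    rw [integral_const_mul]
    rw [integral_prod_mul (fun x => e v x * g x) (fun x => (starRingEnd ℂ) (e v x * g x))]
    rw [integral_conj, Complex.mul_conj]
    rw [Complex.normSq_eq_norm_sq]; push_cast; rfl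
  have hGint := hint3.integral_prod_left
  simp only [hGm] at hGint
  have hGint' : Integrable (fun v => w v * ‖G v‖ ^ 2) ν := by
    have := hGint.re
    simp only [RCLike.re_to_complex, Complex.ofReal_re] at this
    exact this
  have hL : ∫⁻ v, ENNReal.ofReal (w v) * ‖G v‖ₑ ^ 2 ∂ν
      = ‖∫ v, ((w v * ‖G v‖ ^ 2 : ℝ) : ℂ) ∂ν‖ₑ := by
    rw [integral_complex_ofReal, ← ofReal_norm, Complex.norm_real, Real.norm_of_nonneg
      (integral_nonneg fun v => mul_nonneg (hw0 v) (sq_nonneg _)),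
      ofReal_integral_eq_lintegral_ofReal hGint' (Filter.Eventually.of_forall fun v =>
        mul_nonneg (hw0 v) (sq_nonneg _))]
    refine lintegral_congr fun v => ?_
    rw [ENNReal.ofReal_mul (hw0 v), ENNReal.ofReal_pow (norm_nonneg _), ofReal_norm]
  rw [hL]
  simp only [← hGm]
  rw [integral_integral_swap (f := fun v (p : X × X) => ((w v : ℂ)) * (e v p.1 * g p.1) * (starRingEnd ℂ) (e v p.2 * g p.2)) hint3]
  have hgm : AEMeasurable (fun x => ‖g x‖ₑ) μ := hg.aestronglyMeasurable.enorm
  have hg1 : AEMeasurable (fun p : X × X => ‖g p.1‖ₑ) (μ.prod μ) :=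
    hg.aestronglyMeasurable.comp_fst.enorm
  have hg2 : AEMeasurable (fun p : X × X => ‖g p.2‖ₑ) (μ.prod μ) :=
    hg.aestronglyMeasurable.comp_snd.enorm
  have hKm : AEMeasurable (fun p : X × X => K p.1 p.2) (μ.prod μ) := hK.aemeasurable
  have hA : ∫⁻ p : X × X, ‖g p.1‖ₑ ^ 2 * K p.1 p.2 ∂(μ.prod μ) ≤ M * ∫⁻ x, ‖g x‖ₑ ^ 2 ∂μ := by
    rw [lintegral_prod _ (by fun_prop : AEMeasurable (fun p : X × X => ‖g p.1‖ₑ ^ 2 * K p.1 p.2) (μ.prod μ))]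
    rw [← lintegral_const_mul'' _ (hgm.pow_const 2)]
    refine lintegral_mono_ae ?_
    filter_upwards [hM] with x hx
    have : Measurable fun y => K x y := hK.comp (by fun_prop : Measurable fun y : X => (x, y))
    rw [lintegral_const_mul _ this, mul_comm]
    gcongr
  have hB : ∫⁻ p : X × X, ‖g p.2‖ₑ ^ 2 * K p.1 p.2 ∂(μ.prod μ) ≤ M * ∫⁻ x, ‖g x‖ₑ ^ 2 ∂μ := by
    rw [lintegral_prod_symm _ (by fun_prop : AEMeasurable (fun p : X × X => ‖g p.2‖ₑ ^ 2 * K p.1 p.2) (μ.prod μ))]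
    rw [← lintegral_const_mul'' _ (hgm.pow_const 2)]
    refine lintegral_mono_ae ?_
    filter_upwards [hM] with x hx
    have : Measurable fun y => K x y := hK.comp (by fun_prop : Measurable fun y : X => (x, y))
    simp only [hKs _ x]
    rw [lintegral_const_mul _ this, mul_comm]
    gcongr
  have hC : ‖∫ p : X × X, ∫ v, ((w v : ℂ)) * (e v p.1 * g p.1) * (starRingEnd ℂ) (e v p.2 * g p.2) ∂ν ∂(μ.prod μ)‖ₑ
      ≤ ∫⁻ p : X × X, ‖g p.1‖ₑ * ‖g p.2‖ₑ * K p.1 p.2 ∂(μ.prod μ) := by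
    refine (enorm_integral_le_lintegral_enorm _).trans (lintegral_mono fun p => ?_)
    have : ∀ v, ((w v : ℂ)) * (e v p.1 * g p.1) * (starRingEnd ℂ) (e v p.2 * g p.2)
      = (g p.1 * (starRingEnd ℂ) (g p.2)) * ((w v : ℂ) * e v p.1 * (starRingEnd ℂ) (e v p.2)) := by
      intro v; simp only [map_mul]; ring
    simp only [this]
    rw [integral_const_mul, enorm_mul, enorm_mul]
    have : ‖(starRingEnd ℂ) (g p.2)‖ₑ = ‖g p.2‖ₑ := by
      rw [← ofReal_norm, RCLike.norm_conj, ofReal_norm]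
    rw [this]
    gcongr
    exact hKe _ _
  have hD : 2 * ∫⁻ p : X × X, ‖g p.1‖ₑ * ‖g p.2‖ₑ * K p.1 p.2 ∂(μ.prod μ)
      ≤ 2 * (M * ∫⁻ x, ‖g x‖ₑ ^ 2 ∂μ) := by
    rw [← lintegral_const_mul'' _ (by fun_prop : AEMeasurable (fun p : X × X => ‖g p.1‖ₑ * ‖g p.2‖ₑ * K p.1 p.2) (μ.prod μ))]
    calc _ ≤ ∫⁻ p : X × X, (‖g p.1‖ₑ ^ 2 * K p.1 p.2 + ‖g p.2‖ₑ ^ 2 * K p.1 p.2) ∂(μ.prod μ) := by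
          refine lintegral_mono fun p => ?_
          rw [← mul_assoc, ← add_mul]
          gcongr
          exact ennreal_mul_le_sq _ _
      _ ≤ _ := by
          rw [lintegral_add_left' (by fun_prop : AEMeasurable (fun p : X × X => ‖g p.1‖ₑ ^ 2 * K p.1 p.2) (μ.prod μ)), two_mul]
          exact add_le_add hA hB
  refine hC.trans ?_
  exact (ENNReal.mul_le_mul_iff_right (by norm_num) (by norm_num)).1 hD

/-- Minkowski for countable sums -/
lemma mink_tsum {α : Type*} [MeasurableSpace α] (μ : Measure α) {p : ℝ} (hp : 1 ≤ p)
    (f : ℕ → α → ℝ≥0∞) (hf : ∀ i, Measurable (f i)) :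
    (∫⁻ a, (∑' i, f i a) ^ p ∂μ) ^ (1 / p) ≤ ∑' i, (∫⁻ a, (f i a) ^ p ∂μ) ^ (1 / p) := by
  have hp0 : 0 < p := by linarith
  have hfin : ∀ N : ℕ, (∫⁻ a, (∑ i ∈ Finset.range N, f i a) ^ p ∂μ) ^ (1 / p)
      ≤ ∑ i ∈ Finset.range N, (∫⁻ a, (f i a) ^ p ∂μ) ^ (1 / p) := by
    intro N
    induction N with
    | zero => simp [hp0]
    | succ N ih =>
      simp only [Finset.sum_range_succ]
      have := ENNReal.lintegral_Lp_add_le (μ := μ) (f := fun a => ∑ i ∈ Finset.range N, f i a) (g := f N)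
        (Finset.measurable_sum _ (fun i _ => hf i)).aemeasurable (hf N).aemeasurable hp
      refine this.trans ?_
      gcongr
  have h1 : ∀ a, (∑' i, f i a) ^ p = ⨆ N : ℕ, (∑ i ∈ Finset.range N, f i a) ^ p := by
    intro a
    rw [ENNReal.tsum_eq_iSup_nat]
    exact (ENNReal.orderIsoRpow p hp0).map_iSup _
  simp only [h1]
  rw [lintegral_iSup (fun N => (Finset.measurable_sum _ (fun i _ => hf i)).pow_const p)
    (fun i j hij a => by
      simp only
      gcongr)]
  have := (ENNReal.orderIsoRpow (1/p) (by positivity)).map_iSup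
    (fun N : ℕ => ∫⁻ a, (∑ i ∈ Finset.range N, f i a) ^ p ∂μ)
  simp only [ENNReal.orderIsoRpow_apply] at this
  rw [this]
  exact iSup_le fun N => (hfin N).trans (ENNReal.sum_le_tsum _)

lemma mink_tsum_int {α : Type*} [MeasurableSpace α] (μ : Measure α) {p : ℝ} (hp : 1 ≤ p)
    (f : ℤ → α → ℝ≥0∞) (hf : ∀ i, Measurable (f i)) :
    (∫⁻ a, (∑' i, f i a) ^ p ∂μ) ^ (1 / p) ≤ ∑' i, (∫⁻ a, (f i a) ^ p ∂μ) ^ (1 / p) := by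
  have h := mink_tsum μ hp (fun i => f (Equiv.intEquivNat.symm i)) (fun i => hf _)
  have h1 : ∀ a, ∑' i, f (Equiv.intEquivNat.symm i) a = ∑' i, f i a := fun a =>
    Equiv.intEquivNat.symm.tsum_eq (fun i => f i a)
  have h2 := Equiv.intEquivNat.symm.tsum_eq (fun i => (∫⁻ a, (f i a) ^ p ∂μ) ^ (1 / p))
  simp only [h1, h2] at h
  exact h

/-- Cauchy-Schwarz for sums over the integers -/
lemma cs_tsum (f g : ℤ → ℝ≥0∞) : (∑' i, f i * g i) ^ 2 ≤ (∑' i, f i ^ 2) * ∑' i, g i ^ 2 := by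
  have := ENNReal.lintegral_mul_le_Lp_mul_Lq (Measure.count : Measure ℤ)
    (p := 2) (q := 2) (by constructor <;> norm_num) (f := f) (g := g)
    (measurable_of_countable _).aemeasurable (measurable_of_countable _).aemeasurable
  simp only [lintegral_count, Pi.mul_apply] at this
  calc _ ≤ ((∑' i, f i ^ (2:ℝ)) ^ (1 / 2 : ℝ) * (∑' i, g i ^ (2:ℝ)) ^ (1 / 2 : ℝ)) ^ 2 := by gcongr
    _ = _ := by
      rw [mul_pow, ← ENNReal.rpow_natCast, ← ENNReal.rpow_natCast, ← ENNReal.rpow_mul, ← ENNReal.rpow_mul]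
      norm_num

lemma cs_lint {α : Type*} [MeasurableSpace α] (μ : Measure α) (f g : α → ℝ≥0∞)
    (hf : AEMeasurable f μ) (hg : AEMeasurable g μ) :
    (∫⁻ a, f a * g a ∂μ) ^ 2 ≤ (∫⁻ a, f a ^ 2 ∂μ) * ∫⁻ a, g a ^ 2 ∂μ := by
  have := ENNReal.lintegral_mul_le_Lp_mul_Lq μ
    (p := 2) (q := 2) (by constructor <;> norm_num) hf hg
  simp only [Pi.mul_apply] at this
  calc _ ≤ ((∫⁻ a, f a ^ (2:ℝ) ∂μ) ^ (1 / 2 : ℝ) * (∫⁻ a, g a ^ (2:ℝ) ∂μ) ^ (1 / 2 : ℝ)) ^ 2 := by gcongr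
    _ = _ := by
      rw [mul_pow, ← ENNReal.rpow_natCast, ← ENNReal.rpow_natCast, ← ENNReal.rpow_mul, ← ENNReal.rpow_mul]
      norm_num


lemma gauss_ft (n : ℕ) {b : ℝ} (hb : 0 < b) (y z : Euc n) :
    ∫ v : Euc n, ((rexp (-b * ‖v‖ ^ 2) : ℝ) : ℂ) * Complex.exp (2 * π * Complex.I * (⟪v, y⟫ : ℝ)) *
      (starRingEnd ℂ) (Complex.exp (2 * π * Complex.I * (⟪v, z⟫ : ℝ)))
      = (((π / b) ^ ((n:ℝ)/2) * rexp (-(π ^ 2 / b) * ‖y - z‖ ^ 2) : ℝ) : ℂ) := by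
  have h := GaussianFourier.integral_cexp_neg_mul_sq_norm_add (V := Euc n) (b := (b:ℂ)) (by simpa using hb)
    (2 * π * Complex.I) (y - z)
  have e1 : ∀ v : Euc n, ((rexp (-b * ‖v‖ ^ 2) : ℝ) : ℂ) * Complex.exp (2 * π * Complex.I * (⟪v, y⟫ : ℝ)) *
      (starRingEnd ℂ) (Complex.exp (2 * π * Complex.I * (⟪v, z⟫ : ℝ)))
      = Complex.exp (-(b:ℂ) * ‖v‖ ^ 2 + 2 * π * Complex.I * (⟪y - z, v⟫ : ℝ)) := by
    intro v
    rw [← Complex.exp_conj, Complex.ofReal_exp, ← Complex.exp_add, ← Complex.exp_add]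
    congr 1
    simp only [map_mul, Complex.conj_ofReal, Complex.conj_I, inner_sub_right, real_inner_comm v, map_ofNat]
    push_cast
    ring
  simp only [e1]
  rw [h]
  rw [Complex.ofReal_mul, Complex.ofReal_cpow (by positivity), Complex.ofReal_exp]
  simp only [finrank_euclideanSpace, Fintype.card_fin]
  push_cast
  congr 2
  have : (b:ℂ) ≠ 0 := by exact_mod_cast hb.ne'
  field_simp
  rw [Complex.I_sq]; ring

lemma gauss_integrable (n : ℕ) {b : ℝ} (hb : 0 < b) :
    Integrable (fun x : Euc n => rexp (-b * ‖x‖ ^ 2)) := by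
  have := (GaussianFourier.integrable_cexp_neg_mul_sq_norm_add (V := Euc n) (b := (b:ℂ)) (by simpa using hb) 0 0).norm
  refine this.congr (Filter.Eventually.of_forall fun x => ?_)
  simp [Complex.norm_exp, ← Complex.ofReal_pow]

/-- frequency annulus -/
def ann (n : ℕ) (L : ℝ) : Set (Euc n) := {ξ | L ≤ ‖ξ‖ ∧ ‖ξ‖ < 2 * L}

lemma ann_meas (n : ℕ) (L : ℝ) : MeasurableSet (ann n L) :=
  (measurableSet_le measurable_const measurable_norm).inter
    (measurableSet_lt measurable_norm measurable_const)

/-- frequency localized half-wave -/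
def uk {n : ℕ} (L : ℝ) (f : Euc n → ℂ) (t : ℝ) (x : Euc n) : ℂ :=
  ∫ ξ in ann n L, Complex.exp (2 * π * Complex.I * (⟪x, ξ⟫ : ℝ)) *
    Complex.exp (Complex.I * t * ‖ξ‖) * f ξ

lemma norm_ph (a : ℝ) : ‖Complex.exp (2 * π * Complex.I * (a : ℝ))‖ = 1 := by
  have : (2 * π * Complex.I * (a : ℝ) : ℂ) = ((2 * π * a : ℝ) : ℂ) * Complex.I := by push_cast; ring
  rw [this, Complex.norm_exp_ofReal_mul_I]

lemma norm_ph2 (t a : ℝ) : ‖Complex.exp (Complex.I * t * (a : ℝ))‖ = 1 := by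
  have : (Complex.I * t * (a : ℝ) : ℂ) = ((t * a : ℝ) : ℂ) * Complex.I := by push_cast; ring
  rw [this, Complex.norm_exp_ofReal_mul_I]

lemma uk_cont {n : ℕ} (L : ℝ) (f : Euc n → ℂ) (hf : Integrable f) :
    Continuous (fun p : ℝ × Euc n => uk L f p.1 p.2) := by
  unfold uk
  refine continuous_of_dominated (bound := fun ξ => ‖f ξ‖) ?_ ?_ hf.norm.integrableOn ?_
  · intro p
    refine AEStronglyMeasurable.mul ?_ hf.aestronglyMeasurable.restrict
    apply Continuous.aestronglyMeasurable
    fun_prop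
  · intro p
    refine Filter.Eventually.of_forall fun ξ => ?_
    rw [norm_mul, norm_mul, norm_ph, norm_ph2]; simp
  · refine Filter.Eventually.of_forall fun ξ => ?_
    fun_prop

lemma uk_bdd {n : ℕ} (L : ℝ) (f : Euc n → ℂ) (t : ℝ) (x : Euc n) :
    ‖uk L f t x‖ ≤ ∫ ξ in ann n L, ‖f ξ‖ := by
  refine (norm_integral_le_integral_norm _).trans (le_of_eq ?_)
  congr 1; ext ξ
  rw [norm_mul, norm_mul, norm_ph, norm_ph2]; simp

/-- squared spherical norm -/
def A2 {n : ℕ} (L : ℝ) (f : Euc n → ℂ) (t r : ℝ) : ℝ≥0∞ :=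
  ∫⁻ ω : Metric.sphere (0 : Euc n) 1, ‖uk L f t (r • (ω : Euc n))‖ₑ ^ 2
    ∂((volume : Measure (Euc n)).toSphere)

lemma A2_lt_top {n : ℕ} (L : ℝ) (f : Euc n → ℂ) (t r : ℝ) : A2 L f t r ≠ ⊤ := by
  have : A2 L f t r ≤ ∫⁻ ω : Metric.sphere (0 : Euc n) 1, (ENNReal.ofReal (∫ ξ in ann n L, ‖f ξ‖)) ^ 2
    ∂((volume : Measure (Euc n)).toSphere) := by
    refine lintegral_mono fun ω => ?_
    rw [← ofReal_norm]
    gcongr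
    exact uk_bdd _ _ _ _
  refine ne_top_of_le_ne_top ?_ this
  rw [lintegral_const]
  exact ENNReal.mul_ne_top (by simp) (measure_ne_top _ _)

lemma A2_meas {n : ℕ} (L : ℝ) (f : Euc n → ℂ) (hf : Integrable f) :
    Measurable (fun p : ℝ × ℝ => A2 L f p.1 p.2) := by
  unfold A2
  apply Measurable.lintegral_prod_right'
    (f := fun q : (ℝ × ℝ) × Metric.sphere (0 : Euc n) 1 => ‖uk L f q.1.1 (q.1.2 • (q.2 : Euc n))‖ₑ ^ 2)
  apply Measurable.pow_const
  apply Measurable.enorm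
  have : Continuous (fun q : (ℝ × ℝ) × Metric.sphere (0 : Euc n) 1 => (q.1.1, q.1.2 • (q.2 : Euc n))) := by
    fun_prop
  exact ((uk_cont L f hf).comp this).measurable

set_option maxHeartbeats 200000 in
/-- trace estimate -/
lemma trace_est (n : ℕ) (hn : 2 ≤ n) : ∃ C : ℝ, 0 < C ∧ ∀ a : ℝ, 0 ≤ a → a ≤ ((n:ℝ)-1)/2 →
    ∀ L : ℝ, 0 < L → ∀ f : Euc n → ℂ, Integrable f → ∀ t r : ℝ, 0 < r →
    A2 L f t r ≤ ENNReal.ofReal (C * L ^ (n:ℝ) * ((r * L) ^ 2) ^ (-a)) * ∫⁻ ξ in ann n L, ‖f ξ‖ₑ ^ 2 := by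
  obtain ⟨C, hC, hS⟩ := sph_bound n hn
  refine ⟨rexp 4 * π ^ ((n:ℝ)/2) * C, by positivity, ?_⟩
  intro a ha ha2 L hL f hf t r hr
  set σ := (volume : Measure (Euc n)).toSphere
  set b : ℝ := (L ^ 2)⁻¹ with hbdef
  have hb : 0 < b := by positivity
  set G : Metric.sphere (0 : Euc n) 1 → ℂ := fun ω => uk L f t (r • (ω : Euc n)) with hGdef
  have hGc0 : Continuous (fun ω : Metric.sphere (0 : Euc n) 1 => (t, r • (ω : Euc n))) := by fun_prop
  have hGc : Continuous G := by
    have := (uk_cont L f hf).comp hGc0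
    exact this
  have hGi : Integrable (fun ω => (starRingEnd ℂ) (G ω)) σ := by
    refine Integrable.of_bound (C := ∫ ξ in ann n L, ‖f ξ‖)
      (Complex.continuous_conj.comp hGc).aestronglyMeasurable (Filter.Eventually.of_forall fun ω => ?_)
    rw [RCLike.norm_conj]
    exact uk_bdd _ _ _ _
  set H : Euc n → ℂ := fun ξ => ∫ ω : Metric.sphere (0 : Euc n) 1,
    Complex.exp (2 * π * Complex.I * (⟪ξ, r • (ω : Euc n)⟫ : ℝ)) * (starRingEnd ℂ) (G ω) ∂σ with hH
  have hA2 : A2 L f t r = ∫⁻ ω, ‖G ω‖ₑ ^ 2 ∂σ := rfl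
  set N2 := ∫⁻ ξ in ann n L, ‖f ξ‖ₑ ^ 2
  -- Schur
  set B : ℝ := (π / b) ^ ((n:ℝ)/2) * (C * (π ^ 2 / b * r ^ 2) ^ (-a)) with hB
  have hsch := schur_tt σ (volume : Measure (Euc n)) (fun ξ => rexp (-b * ‖ξ‖ ^ 2))
    (fun ξ => (Real.exp_pos _).le) (gauss_integrable n hb)
    (fun ξ ω => Complex.exp (2 * π * Complex.I * (⟪ξ, r • (ω : Euc n)⟫ : ℝ)))
    (by
      apply Continuous.measurable
      unfold Function.uncurry
      fun_prop)
    (fun ξ ω => (norm_ph _).le) (fun ω => (starRingEnd ℂ) (G ω)) hGi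
    (fun ω ω' => ENNReal.ofReal ((π / b) ^ ((n:ℝ)/2) * rexp (-(π ^ 2 / b * r ^ 2) * ‖(ω : Euc n) - ω'‖ ^ 2)))
    (by
      apply Measurable.ennreal_ofReal
      apply Continuous.measurable
      fun_prop)
    (fun ω ω' => by simp only [norm_sub_rev])
    (fun ω ω' => by
      rw [gauss_ft n hb, ← ofReal_norm, Complex.norm_real, Real.norm_of_nonneg (by positivity),
        ← smul_sub, norm_smul, mul_pow, Real.norm_eq_abs, sq_abs]
      apply le_of_eq
      congr 3
      ring)
    (ENNReal.ofReal B)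
    (Filter.Eventually.of_forall fun ω => by
      simp only [ENNReal.ofReal_mul (show 0 ≤ (π / b) ^ ((n:ℝ)/2) by positivity)]
      rw [lintegral_const_mul _ (by fun_prop), hB,
        ENNReal.ofReal_mul (show 0 ≤ (π / b) ^ ((n:ℝ)/2) by positivity)]
      gcongr
      exact hS _ (by positivity) ω a ha ha2)
  have hconj : ∀ ω, ‖(starRingEnd ℂ) (G ω)‖ₑ = ‖G ω‖ₑ := fun ω => by
    rw [← ofReal_norm, RCLike.norm_conj, ofReal_norm]
  simp only [hconj] at hsch
  change ∫⁻ ξ, ENNReal.ofReal (rexp (-b * ‖ξ‖ ^ 2)) * ‖H ξ‖ₑ ^ 2 ≤ ENNReal.ofReal B * A2 L f t r at hsch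
  have hHm : Continuous H := by
    refine continuous_of_dominated (bound := fun ω => ‖(starRingEnd ℂ) (G ω)‖) ?_ ?_ hGi.norm ?_
    · intro ξ
      refine AEStronglyMeasurable.mul ?_ hGi.aestronglyMeasurable
      apply Continuous.aestronglyMeasurable
      fun_prop
    · intro ξ
      refine Filter.Eventually.of_forall fun ω => ?_
      rw [norm_mul, norm_ph, one_mul]
    · refine Filter.Eventually.of_forall fun ω => ?_
      fun_prop
  have hH2 : ∫⁻ ξ in ann n L, ‖H ξ‖ₑ ^ 2 ≤ ENNReal.ofReal (rexp 4) * (ENNReal.ofReal B * A2 L f t r) := by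
    calc _ ≤ ∫⁻ ξ in ann n L, ENNReal.ofReal (rexp 4) * (ENNReal.ofReal (rexp (-b * ‖ξ‖ ^ 2)) * ‖H ξ‖ₑ ^ 2) := by
          refine setLIntegral_mono' (ann_meas n L) fun ξ hξ => ?_
          rw [← mul_assoc, ← ENNReal.ofReal_mul (by positivity), ← Real.exp_add]
          have : 1 ≤ ENNReal.ofReal (rexp (4 + -b * ‖ξ‖ ^ 2)) := by
            rw [ENNReal.one_le_ofReal]
            apply Real.one_le_exp
            have h1 : ‖ξ‖ ^ 2 ≤ (2 * L) ^ 2 := by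
              have := hξ.2.le
              gcongr
            have h2 : b * ‖ξ‖ ^ 2 ≤ b * (2 * L) ^ 2 := by gcongr
            have h3 : b * (2 * L) ^ 2 = 4 := by rw [hbdef]; field_simp; norm_num
            linarith
          calc ‖H ξ‖ₑ ^ 2 = 1 * ‖H ξ‖ₑ ^ 2 := by rw [one_mul]
            _ ≤ _ := by gcongr
      _ ≤ ∫⁻ ξ, ENNReal.ofReal (rexp 4) * (ENNReal.ofReal (rexp (-b * ‖ξ‖ ^ 2)) * ‖H ξ‖ₑ ^ 2) :=
          setLIntegral_le_lintegral _ _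
      _ = ENNReal.ofReal (rexp 4) * ∫⁻ ξ, (ENNReal.ofReal (rexp (-b * ‖ξ‖ ^ 2)) * ‖H ξ‖ₑ ^ 2) := by
          rw [lintegral_const_mul']; simp
      _ ≤ _ := by gcongr
  -- duality
  have hdual : A2 L f t r ≤ ∫⁻ ξ in ann n L, ‖f ξ‖ₑ * ‖H ξ‖ₑ := by
    have h1 : A2 L f t r = ‖∫ ω, G ω * (starRingEnd ℂ) (G ω) ∂σ‖ₑ := by
      have : ∀ ω, G ω * (starRingEnd ℂ) (G ω) = ((‖G ω‖ ^ 2 : ℝ) : ℂ) := fun ω => by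
        rw [Complex.mul_conj, Complex.normSq_eq_norm_sq]
      simp only [this]
      rw [integral_complex_ofReal, ← ofReal_norm, Complex.norm_real, Real.norm_of_nonneg
        (integral_nonneg fun v => sq_nonneg _), ofReal_integral_eq_lintegral_ofReal ?_
          (Filter.Eventually.of_forall fun v => sq_nonneg _), hA2]
      · refine lintegral_congr fun v => ?_
        rw [ENNReal.ofReal_pow (norm_nonneg _), ofReal_norm]
      · refine Integrable.of_bound (C := (∫ ξ in ann n L, ‖f ξ‖) ^ 2)
          (hGc.norm.pow 2).aestronglyMeasurable (Filter.Eventually.of_forall fun ω => ?_)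
        rw [norm_pow, norm_norm]
        gcongr
        exact uk_bdd _ _ _ _
    have hIntg : Integrable (Function.uncurry fun (ω : Metric.sphere (0 : Euc n) 1) (ξ : Euc n) =>
        Complex.exp (2 * π * Complex.I * (⟪r • (ω : Euc n), ξ⟫ : ℝ)) *
        Complex.exp (Complex.I * t * ‖ξ‖) * f ξ * (starRingEnd ℂ) (G ω)) (σ.prod (volume.restrict (ann n L))) := by
      have i1 : Integrable (fun p : Metric.sphere (0 : Euc n) 1 × Euc n => (starRingEnd ℂ) (G p.1) * f p.2)
        (σ.prod (volume.restrict (ann n L))) :=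
        Integrable.mul_prod (f := fun ω => (starRingEnd ℂ) (G ω)) (g := f) hGi hf.integrableOn
      have i2 := i1.bdd_mul (c := 1) (f := fun p : Metric.sphere (0 : Euc n) 1 × Euc n =>
        Complex.exp (2 * π * Complex.I * (⟪r • (p.1 : Euc n), p.2⟫ : ℝ)) *
        Complex.exp (Complex.I * t * ‖p.2‖)) (by
          apply Continuous.aestronglyMeasurable
          fun_prop) (Filter.Eventually.of_forall fun p => by
            rw [norm_mul, norm_ph, norm_ph2]; simp)
      refine i2.congr (Filter.Eventually.of_forall fun p => ?_)
      simp only [Function.uncurry]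
      ring
    rw [h1]
    have h2 : ∫ ω, G ω * (starRingEnd ℂ) (G ω) ∂σ = ∫ ξ in ann n L, (Complex.exp (Complex.I * t * ‖ξ‖) * f ξ) * H ξ := by
      calc _ = ∫ ω, ∫ ξ in ann n L, Complex.exp (2 * π * Complex.I * (⟪r • (ω : Euc n), ξ⟫ : ℝ)) *
        Complex.exp (Complex.I * t * ‖ξ‖) * f ξ * (starRingEnd ℂ) (G ω) ∂volume ∂σ := by
            congr 1; ext ω
            rw [integral_mul_const]; rfl
        _ = _ := by
            rw [integral_integral_swap hIntg]
            congr 1; ext ξ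
            rw [hH, ← integral_const_mul]
            congr 1; ext ω
            rw [real_inner_comm]; ring
    rw [h2]
    refine (enorm_integral_le_lintegral_enorm _).trans (lintegral_mono fun ξ => ?_)
    rw [enorm_mul, enorm_mul, ← ofReal_norm (Complex.exp _), norm_ph2]
    simp
  have hfin := A2_lt_top L f t r
  have hcs := cs_lint (volume.restrict (ann n L)) (fun ξ => ‖f ξ‖ₑ) (fun ξ => ‖H ξ‖ₑ)
    hf.aestronglyMeasurable.restrict.enorm hHm.measurable.enorm.aemeasurable
  have hsq : A2 L f t r ^ 2 ≤ N2 * (ENNReal.ofReal (rexp 4) * (ENNReal.ofReal B * A2 L f t r)) :=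
    calc _ ≤ (∫⁻ ξ in ann n L, ‖f ξ‖ₑ * ‖H ξ‖ₑ) ^ 2 := by gcongr
      _ ≤ _ := hcs.trans (by gcongr)
  have hmain : A2 L f t r ≤ ENNReal.ofReal (rexp 4 * B) * N2 := by
    rcases eq_or_ne (A2 L f t r) 0 with h0 | h0
    · rw [h0]; exact bot_le
    · refine (ENNReal.mul_le_mul_iff_left h0 hfin).1 ?_
      rw [← sq]
      refine hsq.trans (le_of_eq ?_)
      rw [ENNReal.ofReal_mul (Real.exp_pos 4).le]; ring
  refine hmain.trans ?_
  refine mul_le_mul_left (ENNReal.ofReal_le_ofReal ?_) _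
  rw [hB]
  have e1 : (π / b) ^ ((n:ℝ)/2) = π ^ ((n:ℝ)/2) * L ^ (n:ℝ) := by
    have : π / b = π * L ^ 2 := by rw [hbdef]; field_simp
    rw [this, Real.mul_rpow pi_pos.le (by positivity), ← Real.rpow_natCast L, ← Real.rpow_mul hL.le]
    congr 2; push_cast; ring
  have e2 : (π ^ 2 / b * r ^ 2) ^ (-a) ≤ ((r * L) ^ 2) ^ (-a) := by
    have : π ^ 2 / b * r ^ 2 = π ^ 2 * (r * L) ^ 2 := by rw [hbdef]; field_simp
    rw [this]
    apply Real.rpow_le_rpow_of_nonpos (by positivity) _ (by linarith)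
    have : 1 ≤ π ^ 2 := by nlinarith [Real.pi_gt_three]
    nlinarith [sq_nonneg (r * L)]
  rw [e1]
  calc rexp 4 * (π ^ ((n:ℝ)/2) * L ^ (n:ℝ) * (C * (π ^ 2 / b * r ^ 2) ^ (-a)))
      ≤ rexp 4 * (π ^ ((n:ℝ)/2) * L ^ (n:ℝ) * (C * ((r * L) ^ 2) ^ (-a))) := by gcongr
    _ = _ := by ring


lemma gauss1_ft {b : ℝ} (hb : 0 < b) (y z : ℝ) :
    ∫ v : ℝ, ((rexp (-b * v ^ 2) : ℝ) : ℂ) * Complex.exp (Complex.I * v * y) *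
      (starRingEnd ℂ) (Complex.exp (Complex.I * v * z))
      = (((π / b) ^ (1/2:ℝ) * rexp (-(1 / (4*b)) * (y - z) ^ 2) : ℝ) : ℂ) := by
  have h := fourierIntegral_gaussian (b := (b:ℂ)) (by simpa using hb) ((y - z : ℝ) : ℂ)
  have e1 : ∀ v : ℝ, ((rexp (-b * v ^ 2) : ℝ) : ℂ) * Complex.exp (Complex.I * v * y) *
      (starRingEnd ℂ) (Complex.exp (Complex.I * v * z))
      = Complex.exp (Complex.I * ((y - z : ℝ) : ℂ) * v) * Complex.exp (-(b:ℂ) * v ^ 2) := by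
    intro v
    rw [← Complex.exp_conj, Complex.ofReal_exp, ← Complex.exp_add, ← Complex.exp_add, ← Complex.exp_add]
    congr 1
    simp only [map_mul, Complex.conj_ofReal, Complex.conj_I]
    push_cast
    ring
  simp only [e1]
  rw [h]
  rw [Complex.ofReal_mul, Complex.ofReal_cpow (by positivity), Complex.ofReal_exp]
  push_cast
  congr 2
  have : (b:ℂ) ≠ 0 := by exact_mod_cast hb.ne'
  field_simp

lemma gauss1_lint {ε : ℝ} (hε : 0 < ε) (s : ℝ) :
    ∫⁻ r : ℝ, ENNReal.ofReal ((π / ε) ^ (1/2:ℝ) * rexp (-(1 / (4*ε)) * (s - r) ^ 2)) = ENNReal.ofReal (2 * π) := by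
  have hIntg : Integrable (fun r : ℝ => rexp (-(1 / (4*ε)) * r ^ 2)) :=
    integrable_exp_neg_mul_sq (by positivity)
  have h1 : ∫⁻ r : ℝ, ENNReal.ofReal ((π / ε) ^ (1/2:ℝ) * rexp (-(1 / (4*ε)) * (s - r) ^ 2))
     = ∫⁻ r : ℝ, ENNReal.ofReal ((π / ε) ^ (1/2:ℝ) * rexp (-(1 / (4*ε)) * r ^ 2)) :=
    lintegral_sub_left_eq_self (fun r => ENNReal.ofReal ((π / ε) ^ (1/2:ℝ) * rexp (-(1 / (4*ε)) * r ^ 2))) s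
  rw [h1, ← ofReal_integral_eq_lintegral_ofReal (hIntg.const_mul _)
    (Filter.Eventually.of_forall fun x => by positivity), integral_const_mul, integral_gaussian]
  congr 1
  rw [← Real.sqrt_eq_rpow, ← Real.sqrt_mul (by positivity)]
  rw [show π / ε * (π / (1 / (4 * ε))) = (2 * π) ^ 2 by field_simp; ring]
  exact Real.sqrt_sq (by positivity)

lemma schur_kernel (n : ℕ) (hn : 2 ≤ n) : ∃ C : ℝ, 0 < C ∧ ∀ a : ℝ, 0 ≤ a → a ≤ ((n:ℝ)-1)/2 →
    ∀ L : ℝ, 0 < L → ∀ b : ℝ, 0 < b → ∀ ε : ℝ, 0 < ε → ∀ ξ ∈ ann n L,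
    ∫⁻ η in ann n L, ENNReal.ofReal (((π / ε) ^ (1/2:ℝ) * rexp (-(1 / (4*ε)) * (‖ξ‖ - ‖η‖) ^ 2)) *
      ((π / b) ^ ((n:ℝ)/2) * rexp (-(π ^ 2 / b) * ‖ξ - η‖ ^ 2)))
      ≤ ENNReal.ofReal (C * L ^ ((n:ℝ) - 1) * b ^ (-((n:ℝ)/2)) * (L ^ 2 / b) ^ (-a)) := by
  obtain ⟨C, hC, hS⟩ := sph_bound n hn
  refine ⟨2 * π * 2 ^ ((n:ℝ)-1) * π ^ ((n:ℝ)/2) * C, by positivity, ?_⟩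
  intro a ha ha2 L hL b hb ε hε ξ hξ
  set p : ℝ → ℝ := fun r => (π / ε) ^ (1/2:ℝ) * rexp (-(1 / (4*ε)) * (‖ξ‖ - r) ^ 2) with hp
  have hp0 : ∀ r, 0 ≤ p r := fun r => by rw [hp]; positivity
  set F : Euc n → ℝ≥0∞ := fun η => ENNReal.ofReal (p ‖η‖ *
      ((π / b) ^ ((n:ℝ)/2) * rexp (-(π ^ 2 / b) * ‖ξ - η‖ ^ 2))) with hF
  have hFm : Measurable F := by
    apply Measurable.ennreal_ofReal
    apply Continuous.measurable
    rw [hp]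
    fun_prop
  have hξ0 : 0 < ‖ξ‖ := lt_of_lt_of_le hL hξ.1
  set θ : Metric.sphere (0 : Euc n) 1 := ⟨‖ξ‖⁻¹ • ξ, by
    rw [mem_sphere_zero_iff_norm, norm_smul, norm_inv, norm_norm, inv_mul_cancel₀ hξ0.ne']⟩ with hθ
  have hθξ : ‖ξ‖ • (θ : Euc n) = ξ := by
    rw [hθ]; simp only; rw [smul_smul, mul_inv_cancel₀ hξ0.ne', one_smul]
  set β := π ^ 2 / b * L ^ 2 with hβ
  have hβ0 : 0 < β := by positivity
  set D : ℝ := (2 * L) ^ (n - 1) * ((π / b) ^ ((n:ℝ)/2) * (C * β ^ (-a))) with hD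
  have hD0 : 0 ≤ D := by positivity
  have step : ∫⁻ η in ann n L, F η ≤ ∫⁻ r in Ioi (0:ℝ), ENNReal.ofReal (p r) * ENNReal.ofReal D := by
    rw [← lintegral_indicator (ann_meas n L), polar_lint n hn _ (hFm.indicator (ann_meas n L))]
    refine setLIntegral_mono' measurableSet_Ioi fun r hr => ?_
    have hr0 : 0 < r := hr
    have hnorm : ∀ ω : Metric.sphere (0 : Euc n) 1, ‖r • (ω : Euc n)‖ = r := fun ω => by
      rw [norm_smul, norm_eq_of_mem_sphere, mul_one, Real.norm_of_nonneg hr0.le]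
    by_cases hrL : L ≤ r ∧ r < 2 * L
    · have hb1 : ∀ ω : Metric.sphere (0 : Euc n) 1, (ann n L).indicator F (r • (ω : Euc n)) ≤
          ENNReal.ofReal (p r * (π / b) ^ ((n:ℝ)/2)) * ENNReal.ofReal (rexp (-β * ‖(θ : Euc n) - ω‖ ^ 2)) := by
        intro ω
        refine (indicator_le_self _ _ _).trans ?_
        rw [hF, ← ENNReal.ofReal_mul (by have := hp0 r; positivity)]
        apply ENNReal.ofReal_le_ofReal
        rw [hnorm, mul_assoc (p r)]
        refine mul_le_mul_of_nonneg_left (mul_le_mul_of_nonneg_left ?_ (by positivity)) (hp0 r)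
        apply Real.exp_le_exp.2
        conv_lhs => rw [← hθξ]
        rw [norm_sphere_ineq _ _ (norm_eq_of_mem_sphere θ) (norm_eq_of_mem_sphere ω)]
        have h1 : L ^ 2 ≤ ‖ξ‖ * r := by nlinarith [hξ.1, hrL.1]
        have h2 : L ^ 2 * ‖(θ : Euc n) - ω‖ ^ 2 ≤ ‖ξ‖ * r * ‖(θ : Euc n) - ω‖ ^ 2 := by gcongr
        have h3 : L ^ 2 * ‖(θ : Euc n) - ω‖ ^ 2 ≤ (‖ξ‖ - r) ^ 2 + ‖ξ‖ * r * ‖(θ : Euc n) - ω‖ ^ 2 := by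
          nlinarith [sq_nonneg (‖ξ‖ - r)]
        have h4 := mul_le_mul_of_nonneg_left h3 (show 0 ≤ π ^ 2 / b by positivity)
        rw [hβ]
        linarith
      calc _ ≤ ENNReal.ofReal ((2 * L) ^ (n-1)) * ∫⁻ ω : Metric.sphere (0 : Euc n) 1,
            ENNReal.ofReal (p r * (π / b) ^ ((n:ℝ)/2)) * ENNReal.ofReal (rexp (-β * ‖(θ : Euc n) - ω‖ ^ 2)) ∂(volume.toSphere) := by
            gcongr with ω
            · exact hrL.2.le
            · exact hb1 ω
        _ ≤ ENNReal.ofReal ((2 * L) ^ (n-1)) * (ENNReal.ofReal (p r * (π / b) ^ ((n:ℝ)/2)) *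
              ENNReal.ofReal (C * β ^ (-a))) := by
            rw [lintegral_const_mul' _ _ ENNReal.ofReal_ne_top]
            gcongr
            exact hS β hβ0 θ a ha ha2
        _ = _ := by
            have := hp0 r
            rw [← ENNReal.ofReal_mul (by positivity), ← ENNReal.ofReal_mul (by positivity),
              ← ENNReal.ofReal_mul (by positivity), hD]
            congr 1; ring
    · have : ∀ ω : Metric.sphere (0 : Euc n) 1, (ann n L).indicator F (r • (ω : Euc n)) = 0 := fun ω => by
        apply indicator_of_notMem
        intro h
        have h' := h
        rw [ann, mem_ofPred_eq, hnorm] at h'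
        exact hrL h'
      simp [this]
  refine step.trans ?_
  rw [lintegral_mul_const' _ _ ENNReal.ofReal_ne_top]
  calc _ ≤ (∫⁻ r : ℝ, ENNReal.ofReal (p r)) * ENNReal.ofReal D := by
        gcongr
        exact Measure.restrict_le_self
    _ = ENNReal.ofReal (2 * π * D) := by
        rw [gauss1_lint hε, ← ENNReal.ofReal_mul (by positivity)]
    _ ≤ _ := by
        apply ENNReal.ofReal_le_ofReal
        rw [hD]
        have e1 : (2 * L) ^ (n - 1) = 2 ^ ((n:ℝ)-1) * L ^ ((n:ℝ)-1) := by
          rw [← Real.rpow_natCast, Nat.cast_sub (by omega), Real.mul_rpow (by norm_num) hL.le]; norm_num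
        have e2 : (π / b) ^ ((n:ℝ)/2) = π ^ ((n:ℝ)/2) * b ^ (-((n:ℝ)/2)) := by
          rw [Real.div_rpow pi_pos.le hb.le, Real.rpow_neg hb.le]; rfl
        have e3 : β ^ (-a) ≤ (L ^ 2 / b) ^ (-a) := by
          apply Real.rpow_le_rpow_of_nonpos (by positivity) _ (by linarith)
          have : 1 ≤ π ^ 2 := by nlinarith [Real.pi_gt_three]
          rw [hβ, show π ^ 2 / b * L ^ 2 = π ^ 2 * (L ^ 2 / b) by ring]
          exact le_mul_of_one_le_left (by positivity) this
        rw [e1, e2]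
        calc _ ≤ 2 * π * (2 ^ ((n:ℝ)-1) * L ^ ((n:ℝ)-1) * (π ^ ((n:ℝ)/2) * b ^ (-((n:ℝ)/2)) * (C * (L ^ 2 / b) ^ (-a)))) := by gcongr
          _ = _ := by ring


lemma l2_gauss (n : ℕ) (hn : 2 ≤ n) : ∃ C : ℝ, 0 < C ∧ ∀ a : ℝ, 0 ≤ a → a ≤ ((n:ℝ)-1)/2 →
    ∀ L : ℝ, 0 < L → ∀ b : ℝ, 0 < b → ∀ f : Euc n → ℂ, Integrable f →
    ∫⁻ v : ℝ × Euc n, ENNReal.ofReal (rexp (-b * ‖v.2‖ ^ 2)) * ‖uk L f v.1 v.2‖ₑ ^ 2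
      ≤ ENNReal.ofReal (C * L ^ ((n:ℝ) - 1) * b ^ (-((n:ℝ)/2)) * (L ^ 2 / b) ^ (-a)) *
        ∫⁻ ξ in ann n L, ‖f ξ‖ₑ ^ 2 := by
  obtain ⟨C, hC, hS⟩ := schur_kernel n hn
  refine ⟨C, hC, ?_⟩
  intro a ha ha2 L hL b hb f hf
  set M := ENNReal.ofReal (C * L ^ ((n:ℝ) - 1) * b ^ (-((n:ℝ)/2)) * (L ^ 2 / b) ^ (-a))
  have heps : ∀ ε : ℝ, 0 < ε → ∫⁻ v : ℝ × Euc n,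
      ENNReal.ofReal (rexp (-ε * v.1 ^ 2) * rexp (-b * ‖v.2‖ ^ 2)) * ‖uk L f v.1 v.2‖ₑ ^ 2 ≤
      M * ∫⁻ ξ in ann n L, ‖f ξ‖ₑ ^ 2 := by
    intro ε hε
    refine schur_tt (volume.restrict (ann n L)) (volume : Measure (ℝ × Euc n))
      (fun v => rexp (-ε * v.1 ^ 2) * rexp (-b * ‖v.2‖ ^ 2)) (fun v => by positivity)
      (Integrable.mul_prod (f := fun t : ℝ => rexp (-ε * t ^ 2)) (integrable_exp_neg_mul_sq hε) (gauss_integrable n hb))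
      (fun v ξ => Complex.exp (2 * π * Complex.I * (⟪v.2, ξ⟫ : ℝ)) * Complex.exp (Complex.I * v.1 * ‖ξ‖))
      ?_ ?_ f hf.integrableOn
      (fun ξ η => ENNReal.ofReal (((π / ε) ^ (1/2:ℝ) * rexp (-(1 / (4*ε)) * (‖ξ‖ - ‖η‖) ^ 2)) *
      ((π / b) ^ ((n:ℝ)/2) * rexp (-(π ^ 2 / b) * ‖ξ - η‖ ^ 2)))) ?_ ?_ ?_ M ?_
    · apply Continuous.measurable
      unfold Function.uncurry
      fun_prop
    · intro v ξ
      rw [norm_mul, norm_ph, norm_ph2]; simp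
    · apply Measurable.ennreal_ofReal
      apply Continuous.measurable
      fun_prop
    · intro ξ η
      rw [norm_sub_rev ξ η, show (‖ξ‖ - ‖η‖) ^ 2 = (‖η‖ - ‖ξ‖) ^ 2 by ring]
    · intro ξ η
      have e : ∀ v : ℝ × Euc n, ((rexp (-ε * v.1 ^ 2) * rexp (-b * ‖v.2‖ ^ 2) : ℝ) : ℂ) *
          (Complex.exp (2 * π * Complex.I * (⟪v.2, ξ⟫ : ℝ)) * Complex.exp (Complex.I * v.1 * ‖ξ‖)) *
          (starRingEnd ℂ) (Complex.exp (2 * π * Complex.I * (⟪v.2, η⟫ : ℝ)) * Complex.exp (Complex.I * v.1 * ‖η‖))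
          = (((rexp (-ε * v.1 ^ 2) : ℝ) : ℂ) * Complex.exp (Complex.I * v.1 * ‖ξ‖) *
      (starRingEnd ℂ) (Complex.exp (Complex.I * v.1 * ‖η‖))) * (((rexp (-b * ‖v.2‖ ^ 2) : ℝ) : ℂ) * Complex.exp (2 * π * Complex.I * (⟪v.2, ξ⟫ : ℝ)) *
      (starRingEnd ℂ) (Complex.exp (2 * π * Complex.I * (⟪v.2, η⟫ : ℝ)))) := by
        intro v
        rw [map_mul, Complex.ofReal_mul]; ring
      simp only [e]
      rw [Measure.volume_eq_prod, integral_prod_mul (fun t : ℝ => ((rexp (-ε * t ^ 2) : ℝ) : ℂ) * Complex.exp (Complex.I * t * ‖ξ‖) *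
        (starRingEnd ℂ) (Complex.exp (Complex.I * t * ‖η‖)))
        (fun x : Euc n => ((rexp (-b * ‖x‖ ^ 2) : ℝ) : ℂ) * Complex.exp (2 * π * Complex.I * (⟪x, ξ⟫ : ℝ)) *
        (starRingEnd ℂ) (Complex.exp (2 * π * Complex.I * (⟪x, η⟫ : ℝ)))),
        gauss1_ft hε, gauss_ft n hb, ← Complex.ofReal_mul, ← ofReal_norm, Complex.norm_real,
        Real.norm_of_nonneg (by positivity)]
    · filter_upwards [self_mem_ae_restrict (ann_meas n L)] with ξ hξ
      exact hS a ha ha2 L hL b hb ε hε ξ hξ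
  have hmu : Measurable (fun v : ℝ × Euc n => ‖uk L f v.1 v.2‖ₑ ^ 2) :=
    ((uk_cont L f hf).measurable.enorm).pow_const _
  have hlim := lintegral_tendsto_of_tendsto_of_monotone (μ := (volume : Measure (ℝ × Euc n)))
    (f := fun (m : ℕ) v => ENNReal.ofReal (rexp (-(1 / ((m:ℝ) + 1)) * v.1 ^ 2) * rexp (-b * ‖v.2‖ ^ 2)) * ‖uk L f v.1 v.2‖ₑ ^ 2)
    (F := fun v => ENNReal.ofReal (rexp (-b * ‖v.2‖ ^ 2)) * ‖uk L f v.1 v.2‖ₑ ^ 2)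
    (fun m => by
      refine AEMeasurable.mul (Measurable.aemeasurable ?_) hmu.aemeasurable
      apply Measurable.ennreal_ofReal
      apply Continuous.measurable
      fun_prop)
    (Filter.Eventually.of_forall fun v => by
      intro m m' hmm
      simp only
      gcongr)
    (Filter.Eventually.of_forall fun v => by
      refine ENNReal.Tendsto.mul_const ?_ (Or.inr (by simp))
      apply ENNReal.tendsto_ofReal
      have h1 : Filter.Tendsto (fun m : ℕ => rexp (-(1 / ((m:ℝ) + 1)) * v.1 ^ 2) * rexp (-b * ‖v.2‖ ^ 2)) Filter.atTop
        (nhds (rexp (-0 * v.1 ^ 2) * rexp (-b * ‖v.2‖ ^ 2))) := by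
        refine Filter.Tendsto.mul_const _ ?_
        refine (Real.continuous_exp.tendsto _).comp ?_
        refine Filter.Tendsto.mul_const _ ?_
        exact tendsto_one_div_add_atTop_nhds_zero_nat.neg
      simpa using h1)
  exact le_of_tendsto' hlim fun m => heps _ (by positivity)


lemma gamma_lint {τ : ℝ} (hτ : 0 < τ) {s : ℝ} (hs : 0 ≤ s) :
    ENNReal.ofReal (Real.Gamma (τ + 1/2) * s ^ (-(1 + 2 * τ))) ≤
    ∫⁻ b in Ioi (0:ℝ), ENNReal.ofReal (b ^ (τ - 1/2)) * ENNReal.ofReal (rexp (-b * s ^ 2)) := by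
  rcases hs.eq_or_lt with h0 | h0
  · rw [← h0, Real.zero_rpow (by linarith)]; simp
  · have h := Real.integral_rpow_mul_exp_neg_mul_Ioi (a := τ + 1/2) (r := s ^ 2) (by linarith) (by positivity)
    have hG : 0 < Real.Gamma (τ + 1/2) := Real.Gamma_pos_of_pos (by linarith)
    have hi : Integrable (fun t : ℝ => t ^ (τ + 1/2 - 1) * rexp (-(s ^ 2 * t))) (volume.restrict (Ioi 0)) := by
      by_contra hc
      rw [integral_undef hc] at h
      have : 0 < (1 / s ^ 2) ^ (τ + 1/2) * Real.Gamma (τ + 1/2) := by positivity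
      linarith
    have e : (1 / s ^ 2) ^ (τ + 1/2) * Real.Gamma (τ + 1/2) = Real.Gamma (τ + 1/2) * s ^ (-(1 + 2 * τ)) := by
      rw [one_div, ← Real.rpow_natCast, ← Real.rpow_neg h0.le, ← Real.rpow_mul h0.le, mul_comm]
      congr 2; push_cast; ring
    rw [← e, ← h, ofReal_integral_eq_lintegral_ofReal hi]
    · refine setLIntegral_mono' measurableSet_Ioi fun b hb => ?_
      have hb0 : (0:ℝ) < b := hb
      rw [← ENNReal.ofReal_mul (by positivity)]
      apply ENNReal.ofReal_le_ofReal
      rw [show τ + 1/2 - 1 = τ - 1/2 by ring, show -(s ^ 2 * b) = -b * s ^ 2 by ring]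
    · filter_upwards [self_mem_ae_restrict measurableSet_Ioi] with b hb
      have hb0 : (0:ℝ) < b := hb
      simp only [Pi.zero_apply]
      positivity

lemma b_lint_low {τ : ℝ} (hτ : 0 < τ) {L : ℝ} (hL : 0 < L) :
    ∫⁻ b in Ioc (0:ℝ) (L ^ 2), ENNReal.ofReal (b ^ (τ - 1)) = ENNReal.ofReal (L ^ (2 * τ) / τ) := by
  have hi : IntervalIntegrable (fun b : ℝ => b ^ (τ - 1)) volume 0 (L ^ 2) :=
    intervalIntegral.intervalIntegrable_rpow' (by linarith)
  have hi' := (intervalIntegrable_iff_integrableOn_Ioc_of_le (by positivity)).1 hi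
  rw [← ofReal_integral_eq_lintegral_ofReal hi']
  · rw [← intervalIntegral.integral_of_le (by positivity), integral_rpow (Or.inl (by linarith))]
    congr 1
    rw [sub_add_cancel, Real.zero_rpow hτ.ne', sub_zero, ← Real.rpow_natCast, ← Real.rpow_mul hL.le]
    norm_num
  · filter_upwards [self_mem_ae_restrict measurableSet_Ioc] with b hb
    have hb0 : (0:ℝ) < b := hb.1
    simp only [Pi.zero_apply]
    positivity

lemma b_lint_high {κ : ℝ} (hκ : 0 < κ) {L : ℝ} (hL : 0 < L) :
    ∫⁻ b in Ioi (L ^ 2), ENNReal.ofReal (b ^ (-κ - 1)) = ENNReal.ofReal (L ^ (-2 * κ) / κ) := by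
  have hL2 : 0 < L ^ 2 := by positivity
  have hi' := integrableOn_Ioi_rpow_of_lt (a := -κ - 1) (by linarith) hL2
  rw [← ofReal_integral_eq_lintegral_ofReal hi']
  · rw [integral_Ioi_rpow_of_lt (by linarith) hL2]
    congr 1
    rw [sub_add_cancel, ← Real.rpow_natCast, ← Real.rpow_mul hL.le, neg_div_neg_eq]
    congr 2; push_cast; ring
  · filter_upwards [self_mem_ae_restrict measurableSet_Ioi] with b hb
    have hb0 : (0:ℝ) < b := hL2.trans hb
    simp only [Pi.zero_apply]
    positivity

lemma l2_x (n : ℕ) (hn : 2 ≤ n) {τ : ℝ} (hτ : 0 < τ) (hτ2 : τ < ((n:ℝ)-1)/2) : ∃ C : ℝ, 0 < C ∧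
    ∀ L : ℝ, 0 < L → ∀ f : Euc n → ℂ, Integrable f →
    ∫⁻ v : ℝ × Euc n, ENNReal.ofReal (‖v.2‖ ^ (-(1 + 2 * τ))) * ‖uk L f v.1 v.2‖ₑ ^ 2
      ≤ ENNReal.ofReal (C * L ^ (2 * τ)) * ∫⁻ ξ in ann n L, ‖f ξ‖ₑ ^ 2 := by
  obtain ⟨C, hC, hS⟩ := l2_gauss n hn
  have hG : 0 < Real.Gamma (τ + 1/2) := Real.Gamma_pos_of_pos (by linarith)
  set κ := ((n:ℝ)-1)/2 - τ with hκ
  have hκ0 : 0 < κ := by rw [hκ]; linarith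
  have hn1 : (0:ℝ) ≤ ((n:ℝ)-1)/2 := by linarith
  refine ⟨(Real.Gamma (τ + 1/2))⁻¹ * (C * (1 / τ + 1 / κ)), by positivity, ?_⟩
  intro L hL f hf
  set N2 := ∫⁻ ξ in ann n L, ‖f ξ‖ₑ ^ 2
  set U : ℝ × Euc n → ℝ≥0∞ := fun v => ‖uk L f v.1 v.2‖ₑ ^ 2 with hU
  have hmu : Measurable U :=
    ((uk_cont L f hf).measurable.enorm).pow_const _
  have key : ENNReal.ofReal (Real.Gamma (τ + 1/2)) * ∫⁻ v : ℝ × Euc n, ENNReal.ofReal (‖v.2‖ ^ (-(1 + 2 * τ))) * U v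
      ≤ ENNReal.ofReal (C * (1 / τ + 1 / κ) * L ^ (2 * τ)) * N2 := by
    calc _ = ∫⁻ v : ℝ × Euc n, ENNReal.ofReal (Real.Gamma (τ + 1/2)) * (ENNReal.ofReal (‖v.2‖ ^ (-(1 + 2 * τ))) * U v) := by
          rw [lintegral_const_mul' _ _ ENNReal.ofReal_ne_top]
      _ ≤ ∫⁻ v : ℝ × Euc n, ∫⁻ b in Ioi (0:ℝ), ENNReal.ofReal (b ^ (τ - 1/2)) * (ENNReal.ofReal (rexp (-b * ‖v.2‖ ^ 2)) * U v) := by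
          refine lintegral_mono fun v => ?_
          rw [← mul_assoc, ← ENNReal.ofReal_mul hG.le]
          simp only [← mul_assoc]
          rw [lintegral_mul_const' _ _ (by rw [hU]; simp)]
          exact mul_le_mul_left (gamma_lint hτ (norm_nonneg _)) _
      _ = ∫⁻ b in Ioi (0:ℝ), ∫⁻ v : ℝ × Euc n, ENNReal.ofReal (b ^ (τ - 1/2)) * (ENNReal.ofReal (rexp (-b * ‖v.2‖ ^ 2)) * U v) := by
          apply lintegral_lintegral_swap
          apply Measurable.aemeasurable
          refine Measurable.mul ?_ (Measurable.mul ?_ (hmu.comp measurable_fst))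
          · apply Measurable.ennreal_ofReal
            exact measurable_snd.pow_const _
          · apply Measurable.ennreal_ofReal
            apply Continuous.measurable
            fun_prop
      _ = ∫⁻ b in Ioi (0:ℝ), ENNReal.ofReal (b ^ (τ - 1/2)) * ∫⁻ v : ℝ × Euc n, (ENNReal.ofReal (rexp (-b * ‖v.2‖ ^ 2)) * U v) := by
          refine lintegral_congr fun b => ?_
          rw [lintegral_const_mul' _ _ ENNReal.ofReal_ne_top]
      _ ≤ (∫⁻ b in Ioc (0:ℝ) (L ^ 2), ENNReal.ofReal (b ^ (τ - 1/2)) * ∫⁻ v : ℝ × Euc n, (ENNReal.ofReal (rexp (-b * ‖v.2‖ ^ 2)) * U v))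
          + ∫⁻ b in Ioi (L ^ 2), ENNReal.ofReal (b ^ (τ - 1/2)) * ∫⁻ v : ℝ × Euc n, (ENNReal.ofReal (rexp (-b * ‖v.2‖ ^ 2)) * U v) := by
          rw [← Ioc_union_Ioi_eq_Ioi (show (0:ℝ) ≤ L ^ 2 by positivity)]
          exact lintegral_union_le _ _ _
      _ ≤ (∫⁻ b in Ioc (0:ℝ) (L ^ 2), ENNReal.ofReal (b ^ (τ - 1)) * (ENNReal.ofReal C * N2))
          + ∫⁻ b in Ioi (L ^ 2), ENNReal.ofReal (b ^ (-κ - 1)) * (ENNReal.ofReal (C * L ^ ((n:ℝ)-1)) * N2) := by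
          refine add_le_add (setLIntegral_mono' measurableSet_Ioc fun b hb => ?_)
            (setLIntegral_mono' measurableSet_Ioi fun b hb => ?_)
          · have hb0 : 0 < b := hb.1
            refine (mul_le_mul_right (hS (((n:ℝ)-1)/2) hn1 le_rfl L hL b hb0 f hf) _).trans (le_of_eq ?_)
            rw [← mul_assoc, ← mul_assoc, ← ENNReal.ofReal_mul (by positivity), ← ENNReal.ofReal_mul (by positivity)]
            congr 2
            have e1 : (L ^ 2 / b) ^ (-(((n:ℝ)-1)/2)) = (L ^ ((n:ℝ)-1))⁻¹ * b ^ (((n:ℝ)-1)/2) := by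
              rw [Real.div_rpow (by positivity) hb0.le, Real.rpow_neg hb0.le, div_inv_eq_mul, ← Real.rpow_natCast,
                ← Real.rpow_mul hL.le, ← Real.rpow_neg hL.le]
              congr 2; push_cast; ring
            have e2 : b ^ (τ - 1) = b ^ (τ - 1/2) * b ^ (-((n:ℝ)/2)) * b ^ (((n:ℝ)-1)/2) := by
              rw [← Real.rpow_add hb0, ← Real.rpow_add hb0]; congr 1; ring
            have e3 : L ^ ((n:ℝ)-1) ≠ 0 := by positivity
            rw [e1, e2]
            field_simp
          · have hb0 : 0 < b := lt_trans (by positivity) hb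
            refine (mul_le_mul_right (hS 0 le_rfl hn1 L hL b hb0 f hf) _).trans (le_of_eq ?_)
            rw [← mul_assoc, ← mul_assoc, ← ENNReal.ofReal_mul (by positivity), ← ENNReal.ofReal_mul (by positivity)]
            congr 2
            have e2 : b ^ (-κ - 1) = b ^ (τ - 1/2) * b ^ (-((n:ℝ)/2)) := by
              rw [← Real.rpow_add hb0]; congr 1; rw [hκ]; ring
            rw [e2, neg_zero, Real.rpow_zero]
            ring
      _ = _ := by
          rw [lintegral_mul_const _ (by fun_prop), lintegral_mul_const _ (by fun_prop), b_lint_low hτ hL, b_lint_high hκ0 hL,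
            ← mul_assoc, ← mul_assoc, ← ENNReal.ofReal_mul (by positivity), ← ENNReal.ofReal_mul (by positivity), ← add_mul,
            ← ENNReal.ofReal_add (by positivity) (by positivity)]
          congr 2
          have e : L ^ (-2 * κ) * L ^ ((n:ℝ)-1) = L ^ (2 * τ) := by
            rw [← Real.rpow_add hL]; congr 1; rw [hκ]; ring
          rw [← e]
          field_simp
  have e1 : ENNReal.ofReal ((Real.Gamma (τ + 1/2))⁻¹ * (C * (1 / τ + 1 / κ)) * L ^ (2 * τ)) * N2 =
      ENNReal.ofReal (Real.Gamma (τ + 1/2))⁻¹ * (ENNReal.ofReal (C * (1 / τ + 1 / κ) * L ^ (2 * τ)) * N2) := by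
    rw [← mul_assoc (ENNReal.ofReal _), ← ENNReal.ofReal_mul (by positivity)]; congr 2; ring
  rw [e1]
  refine le_trans (le_of_eq ?_) (mul_le_mul_right key _)
  rw [← mul_assoc, ← ENNReal.ofReal_mul (by positivity), inv_mul_cancel₀ hG.ne', ENNReal.ofReal_one, one_mul]

lemma l2_est (n : ℕ) (hn : 2 ≤ n) {τ : ℝ} (hτ : 0 < τ) (hτ2 : τ < ((n:ℝ)-1)/2) : ∃ C : ℝ, 0 < C ∧
    ∀ L : ℝ, 0 < L → ∀ f : Euc n → ℂ, Integrable f →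
    ∫⁻ t : ℝ, ∫⁻ r in Ioi (0:ℝ), ENNReal.ofReal (r ^ ((n:ℝ) - 2 - 2 * τ)) * A2 L f t r
      ≤ ENNReal.ofReal (C * L ^ (2 * τ)) * ∫⁻ ξ in ann n L, ‖f ξ‖ₑ ^ 2 := by
  obtain ⟨C, hC, hS⟩ := l2_x n hn hτ hτ2
  refine ⟨C, hC, fun L hL f hf => ?_⟩
  refine le_trans (le_of_eq ?_) (hS L hL f hf)
  have hmu : Measurable (fun v : ℝ × Euc n => ENNReal.ofReal (‖v.2‖ ^ (-(1 + 2 * τ))) * ‖uk L f v.1 v.2‖ₑ ^ 2) := by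
    refine Measurable.mul ?_ (((uk_cont L f hf).measurable.enorm).pow_const _)
    apply Measurable.ennreal_ofReal
    exact (measurable_norm.comp measurable_snd).pow_const _
  rw [Measure.volume_eq_prod, lintegral_prod _ hmu.aemeasurable]
  refine lintegral_congr fun t => ?_
  have hmt : Measurable (fun x : Euc n => ENNReal.ofReal (‖x‖ ^ (-(1 + 2 * τ))) * ‖uk L f t x‖ₑ ^ 2) := by
    have := hmu.comp (measurable_prodMk_left (x := t))
    exact this
  simp only
  rw [polar_lint n hn _ hmt]
  refine setLIntegral_congr_fun measurableSet_Ioi fun r hr => ?_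
  have hr0 : (0:ℝ) < r := hr
  have hnorm : ∀ ω : Metric.sphere (0 : Euc n) 1, ‖r • (ω : Euc n)‖ = r := fun ω => by
    rw [norm_smul, norm_eq_of_mem_sphere, mul_one, Real.norm_of_nonneg hr0.le]
  simp only [hnorm]
  rw [lintegral_const_mul' _ _ ENNReal.ofReal_ne_top, ← mul_assoc, ← ENNReal.ofReal_mul (by positivity)]
  congr 2
  rw [← Real.rpow_natCast, ← Real.rpow_add hr0, Nat.cast_sub (by omega)]
  congr 1; push_cast; ring


lemma choose_a {n q g : ℝ} (hn : 2 ≤ n) (hq : 2 ≤ q) (h1 : 1/2 - 1/q < g) (h2 : g < n/2 - 1/q) :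
    ∃ a : ℝ, 0 ≤ a ∧ a ≤ (n-1)/2 ∧ 0 < (n - q*n/2 + q*g + a*(q-2))/2 ∧
      (n - q*n/2 + q*g + a*(q-2))/2 < (n-1)/2 := by
  have hq0 : 0 < q := by linarith
  have h1' : q/2 - 1 < q * g := by
    have := mul_lt_mul_of_pos_left h1 hq0
    rw [mul_sub, mul_one_div_cancel hq0.ne'] at this
    linarith
  have h2' : q * g < q*n/2 - 1 := by
    have := mul_lt_mul_of_pos_left h2 hq0
    rw [mul_sub, mul_one_div_cancel hq0.ne'] at this
    linarith
  by_cases c1 : 0 < n - q*n/2 + q*g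
  · exact ⟨0, le_rfl, by linarith, by linarith, by linarith⟩
  · by_cases c2 : n - q*n/2 + q*g + (n-1)/2*(q-2) < n-1
    · exact ⟨(n-1)/2, by linarith, le_rfl, by nlinarith, by linarith⟩
    · have hq2 : 0 < q - 2 := by
        rcases hq.eq_or_lt with h | h
        · subst h; exfalso; linarith
        · linarith
      have e : ((n-1)/2 - (n - q*n/2 + q*g)) / (q-2) * (q-2) = (n-1)/2 - (n - q*n/2 + q*g) := by
        field_simp
      refine ⟨((n-1)/2 - (n - q*n/2 + q*g)) / (q-2), ?_, ?_, ?_, ?_⟩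
      · apply div_nonneg <;> linarith
      · rw [div_le_iff₀ hq2]; linarith
      · rw [e]; linarith
      · rw [e]; linarith

lemma dyadic (n : ℕ) (hn : 2 ≤ n) (q g : ℝ) (hq : 2 ≤ q)
    (h1 : 1/2 - 1/q < g) (h2 : g < (n : ℝ) / 2 - 1/q) : ∃ C : ℝ, 0 < C ∧
    ∀ L : ℝ, 0 < L → ∀ f : Euc n → ℂ, Integrable f →
    ∫⁻ t : ℝ, ∫⁻ r in Ioi (0:ℝ), ENNReal.ofReal (r ^ (q * ((n:ℝ)/2 - g) - 2)) * (A2 L f t r) ^ (q/2)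
      ≤ ENNReal.ofReal (C * L ^ (q * g)) * (∫⁻ ξ in ann n L, ‖f ξ‖ₑ ^ 2) ^ (q/2) := by
  obtain ⟨a, ha, ha2, hτ, hτ2⟩ := choose_a (n := (n:ℝ)) (by exact_mod_cast hn) hq h1 h2
  set τ := ((n:ℝ) - q*n/2 + q*g + a*(q-2))/2 with hτdef
  obtain ⟨C1, hC1, hS1⟩ := trace_est n hn
  obtain ⟨C2, hC2, hS2⟩ := l2_est n hn hτ hτ2
  have hq2 : 0 ≤ (q-2)/2 := by linarith
  refine ⟨C1 ^ ((q-2)/2) * C2, by positivity, ?_⟩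
  intro L hL f hf
  set N2 := ∫⁻ ξ in ann n L, ‖f ξ‖ₑ ^ 2
  set D : ℝ := C1 ^ ((q-2)/2) * L ^ ((n:ℝ) * ((q-2)/2)) * L ^ (-(a*(q-2))) with hD
  have hD0 : 0 ≤ D := by positivity
  have hpt : ∀ t : ℝ, ∀ r ∈ Ioi (0:ℝ), ENNReal.ofReal (r ^ (q * ((n:ℝ)/2 - g) - 2)) * (A2 L f t r) ^ (q/2) ≤
      (ENNReal.ofReal D * N2 ^ ((q-2)/2)) * (ENNReal.ofReal (r ^ ((n:ℝ) - 2 - 2 * τ)) * A2 L f t r) := by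
    intro t r hr
    have hr0 : 0 < r := hr
    have e1 : (A2 L f t r) ^ (q/2) = (A2 L f t r) ^ ((q-2)/2) * A2 L f t r := by
      conv_rhs => rw [← ENNReal.rpow_one (A2 L f t r), ← ENNReal.rpow_mul, one_mul]
      rw [← ENNReal.rpow_add_of_nonneg _ _ hq2 zero_le_one]
      congr 1; ring
    have e2 : (A2 L f t r) ^ ((q-2)/2) ≤ ENNReal.ofReal (D * r ^ (-(a*(q-2)))) * N2 ^ ((q-2)/2) := by
      refine (ENNReal.rpow_le_rpow (hS1 a ha ha2 L hL f hf t r hr0) hq2).trans (le_of_eq ?_)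
      rw [ENNReal.mul_rpow_of_nonneg _ _ hq2, ENNReal.ofReal_rpow_of_nonneg (by positivity) hq2]
      congr 2
      rw [Real.mul_rpow (by positivity) (by positivity), Real.mul_rpow (by positivity) (by positivity),
        ← Real.rpow_mul hL.le, ← Real.rpow_natCast (r * L), ← Real.rpow_mul (by positivity), ← Real.rpow_mul (by positivity),
        Real.mul_rpow hr0.le hL.le, hD]
      rw [show ((2:ℕ):ℝ) * (-a * ((q-2)/2)) = -(a*(q-2)) by push_cast; ring]
      ring
    have e3 : r ^ ((n:ℝ) - 2 - 2 * τ) = r ^ (q * ((n:ℝ)/2 - g) - 2) * r ^ (-(a*(q-2))) := by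
      rw [← Real.rpow_add hr0]; congr 1; rw [hτdef]; ring
    calc _ ≤ ENNReal.ofReal (r ^ (q * ((n:ℝ)/2 - g) - 2)) *
        (ENNReal.ofReal (D * r ^ (-(a*(q-2)))) * N2 ^ ((q-2)/2) * A2 L f t r) := by
          rw [e1]; gcongr
      _ = _ := by
          rw [e3, ENNReal.ofReal_mul hD0, ENNReal.ofReal_mul (show 0 ≤ r ^ (q * ((n:ℝ)/2 - g) - 2) by positivity)]; ring
  have hm : Measurable (fun p : ℝ × ℝ => ENNReal.ofReal (p.2 ^ ((n:ℝ) - 2 - 2 * τ)) * A2 L f p.1 p.2) := by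
    refine Measurable.mul ?_ (A2_meas L f hf)
    apply Measurable.ennreal_ofReal
    exact measurable_snd.pow_const _
  calc _ ≤ ∫⁻ t : ℝ, ∫⁻ r in Ioi (0:ℝ), (ENNReal.ofReal D * N2 ^ ((q-2)/2)) * (ENNReal.ofReal (r ^ ((n:ℝ) - 2 - 2 * τ)) * A2 L f t r) :=
        lintegral_mono fun t => setLIntegral_mono' measurableSet_Ioi (hpt t)
    _ = ∫⁻ t : ℝ, (ENNReal.ofReal D * N2 ^ ((q-2)/2)) * ∫⁻ r in Ioi (0:ℝ), (ENNReal.ofReal (r ^ ((n:ℝ) - 2 - 2 * τ)) * A2 L f t r) := by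
        refine lintegral_congr fun t => ?_
        have := hm.comp (measurable_prodMk_left (x := t))
        exact lintegral_const_mul _ this
    _ = (ENNReal.ofReal D * N2 ^ ((q-2)/2)) * ∫⁻ t : ℝ, ∫⁻ r in Ioi (0:ℝ), (ENNReal.ofReal (r ^ ((n:ℝ) - 2 - 2 * τ)) * A2 L f t r) := by
        have := hm.lintegral_prod_right' (ν := volume.restrict (Ioi (0:ℝ)))
        rw [lintegral_const_mul _ this]
    _ ≤ (ENNReal.ofReal D * N2 ^ ((q-2)/2)) * (ENNReal.ofReal (C2 * L ^ (2 * τ)) * N2) := by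
        gcongr
        exact hS2 L hL f hf
    _ = ENNReal.ofReal (D * (C2 * L ^ (2 * τ))) * (N2 ^ ((q-2)/2) * N2) := by
        rw [ENNReal.ofReal_mul hD0]; ring
    _ = _ := by
        congr 1
        · congr 1
          have : L ^ (q * g) = L ^ ((n:ℝ) * ((q-2)/2)) * L ^ (-(a*(q-2))) * L ^ (2*τ) := by
            rw [← Real.rpow_add hL, ← Real.rpow_add hL]; congr 1; rw [hτdef]; ring
          rw [hD, this]; ring
        · conv_lhs => rw [← ENNReal.rpow_one N2, ← ENNReal.rpow_mul, one_mul]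
          rw [← ENNReal.rpow_add_of_nonneg _ _ hq2 zero_le_one]
          congr 1; ring


/-- almost-orthogonality weight -/
def Wt (δ s : ℝ) : ℝ := s ^ δ + s ^ (-δ)

lemma Wt_pos {δ s : ℝ} (hs : 0 < s) : 0 < Wt δ s := by unfold Wt; positivity

lemma wsum {δ : ℝ} (hδ : 0 < δ) : ∃ C : ℝ≥0∞, C ≠ ⊤ ∧ ∀ r : ℝ, 0 < r →
    ∑' k : ℤ, ENNReal.ofReal ((Wt δ (r * 2 ^ k))⁻¹) ^ 2 ≤ C := by
  set B : ℝ := 2 ^ δ with hB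
  have hB1 : 1 < B := Real.one_lt_rpow (by norm_num) hδ
  have hB0 : 0 < B := by linarith
  set h : ℤ → ℝ := fun m => B ^ 2 * (B⁻¹ ^ 2) ^ m.natAbs with hh
  have hgeo : Summable (fun p : ℕ => B ^ 2 * (B⁻¹ ^ 2) ^ p) := by
    apply Summable.mul_left
    apply summable_geometric_of_lt_one (by positivity)
    have : B⁻¹ < 1 := inv_lt_one_of_one_lt₀ hB1
    have h0 : 0 < B⁻¹ := by positivity
    nlinarith
  have hsum : Summable h := by
    apply Summable.of_nat_of_neg
    · simpa [hh] using hgeo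
    · simpa [hh] using hgeo
  refine ⟨∑' m : ℤ, ENNReal.ofReal (h m), hsum.tsum_ofReal_ne_top, ?_⟩
  intro r hr
  obtain ⟨j, hj1, hj2⟩ := exists_mem_Ico_zpow hr (one_lt_two (α := ℝ))
  rw [← Equiv.tsum_eq (Equiv.addLeft j) (fun m => ENNReal.ofReal (h m))]
  refine ENNReal.tsum_le_tsum fun k => ?_
  have hs0 : 0 < r * 2 ^ k := by positivity
  have hlow : B ^ (j + k).natAbs / B ≤ Wt δ (r * 2 ^ k) := by
    have s1 : (2:ℝ) ^ (j + k) ≤ r * 2 ^ k := by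
      rw [zpow_add₀ (by norm_num)]; gcongr
    have s2 : r * 2 ^ k ≤ (2:ℝ) ^ (j + k + 1) := by
      rw [show j + k + 1 = (j + 1) + k by ring, zpow_add₀ (by norm_num)]; gcongr
    have t1 : ((2:ℝ) ^ (j+k)) ^ δ = B ^ (j + k) := by
      rw [hB, ← Real.rpow_intCast, ← Real.rpow_mul (by norm_num), mul_comm, Real.rpow_mul (by norm_num), Real.rpow_intCast]
    have t2 : ((2:ℝ) ^ (j+k+1)) ^ (-δ) = B ^ (-(j + k)) / B := by
      rw [hB, ← Real.rpow_intCast, ← Real.rpow_mul (by norm_num), show ((j + k + 1 : ℤ) : ℝ) * (-δ) = δ * ((-(j+k) - 1 : ℤ) : ℝ) by push_cast; ring,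
        Real.rpow_mul (by norm_num), Real.rpow_intCast, zpow_sub_one₀ (by positivity)]
      rfl
    unfold Wt
    have p1 : 0 < (r * 2 ^ k) ^ δ := by positivity
    have p2 : 0 < (r * 2 ^ k) ^ (-δ) := by positivity
    rcases le_total 0 (j + k) with hm | hm
    · have e : B ^ (j + k).natAbs = B ^ (j + k) := by
        rw [← zpow_natCast, Int.natCast_natAbs, abs_of_nonneg hm]
      have q1 : B ^ (j + k) ≤ (r * 2 ^ k) ^ δ := by
        rw [← t1]; exact Real.rpow_le_rpow (by positivity) s1 hδ.le
      rw [e]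
      have : B ^ (j + k) / B ≤ B ^ (j + k) := div_le_self (by positivity) hB1.le
      linarith
    · have e : B ^ (j + k).natAbs = B ^ (-(j + k)) := by
        rw [← zpow_natCast, Int.natCast_natAbs, abs_of_nonpos hm]
      have q1 : B ^ (-(j + k)) / B ≤ (r * 2 ^ k) ^ (-δ) := by
        rw [← t2]; exact Real.rpow_le_rpow_of_nonpos hs0 s2 (by linarith)
      rw [e]
      linarith
  rw [← ENNReal.ofReal_pow (by have := Wt_pos (δ := δ) hs0; positivity)]
  apply ENNReal.ofReal_le_ofReal
  calc (Wt δ (r * 2 ^ k))⁻¹ ^ 2 ≤ (B ^ (j + k).natAbs / B)⁻¹ ^ 2 := by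
        have := Wt_pos (δ := δ) hs0
        gcongr
    _ = _ := by
        rw [hh]
        simp only [Equiv.coe_addLeft]
        rw [inv_div, div_pow, ← pow_mul, inv_pow, mul_comm _ 2, pow_mul, inv_pow]
        rfl

lemma ann_disj (n : ℕ) : Pairwise (Function.onFun Disjoint fun k : ℤ => ann n ((2:ℝ) ^ k)) := by
  intro k l hkl
  rw [Function.onFun, Set.disjoint_left]
  intro ξ h1 h2
  have a1 : (2:ℝ) ^ k < 2 ^ (l + 1) := by
    rw [zpow_add_one₀ (by norm_num), mul_comm]; exact lt_of_le_of_lt h1.1 h2.2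
  have a2 : (2:ℝ) ^ l < 2 ^ (k + 1) := by
    rw [zpow_add_one₀ (by norm_num), mul_comm]; exact lt_of_le_of_lt h2.1 h1.2
  rw [zpow_lt_zpow_iff_right₀ (by norm_num)] at a1 a2
  omega

lemma ann_union (n : ℕ) : (⋃ k : ℤ, ann n ((2:ℝ) ^ k)) = {0}ᶜ := by
  ext ξ
  simp only [mem_iUnion, mem_compl_iff, mem_singleton_iff]
  constructor
  · rintro ⟨k, hk⟩ h0
    have := hk.1
    rw [h0, norm_zero] at this
    have h2 : (0:ℝ) < 2 ^ k := by positivity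
    linarith
  · intro h0
    obtain ⟨j, hj1, hj2⟩ := exists_mem_Ico_zpow (norm_pos_iff.2 h0) (one_lt_two (α := ℝ))
    refine ⟨j, hj1, ?_⟩
    rwa [zpow_add_one₀ (by norm_num), mul_comm] at hj2

/-- half wave with Fourier data f -/
def Uf {n : ℕ} (f : Euc n → ℂ) (t : ℝ) (x : Euc n) : ℂ :=
  ∫ ξ, Complex.exp (2 * π * Complex.I * (⟪x, ξ⟫ : ℝ)) *
    Complex.exp (Complex.I * t * ‖ξ‖) * f ξ

lemma Uf_le (n : ℕ) (hn : 2 ≤ n) (f : Euc n → ℂ) (hf : Integrable f) (t : ℝ) (x : Euc n) :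
    ‖Uf f t x‖ₑ ≤ ∑' k : ℤ, ‖uk ((2:ℝ) ^ k) f t x‖ₑ := by
  have : Nonempty (Fin n) := ⟨⟨0, by omega⟩⟩
  have hi : Integrable (fun ξ => Complex.exp (2 * π * Complex.I * (⟪x, ξ⟫ : ℝ)) *
    Complex.exp (Complex.I * t * ‖ξ‖) * f ξ) := by
    refine hf.bdd_mul (c := 1) ?_ ?_
    · apply Continuous.aestronglyMeasurable
      fun_prop
    · refine Filter.Eventually.of_forall fun p => ?_
      rw [norm_mul, norm_ph, norm_ph2]; simp
  have hs := hasSum_integral_iUnion (fun k : ℤ => ann_meas n ((2:ℝ) ^ k)) (ann_disj n) hi.integrableOn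
  have e : ∫ ξ in ⋃ k : ℤ, ann n ((2:ℝ) ^ k), Complex.exp (2 * π * Complex.I * (⟪x, ξ⟫ : ℝ)) *
    Complex.exp (Complex.I * t * ‖ξ‖) * f ξ = Uf f t x := by
    rw [ann_union, Uf]
    rw [show (∫ ξ, Complex.exp (2 * π * Complex.I * (⟪x, ξ⟫ : ℝ)) *
      Complex.exp (Complex.I * t * ‖ξ‖) * f ξ) = ∫ ξ in univ, Complex.exp (2 * π * Complex.I * (⟪x, ξ⟫ : ℝ)) *
      Complex.exp (Complex.I * t * ‖ξ‖) * f ξ by rw [Measure.restrict_univ]]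
    apply setIntegral_congr_set
    exact (ae_eq_univ.2 (by rw [compl_compl]; exact measure_singleton 0))
  rw [e] at hs
  rw [← hs.tsum_eq]
  exact enorm_tsum_le_tsum_enorm

lemma sum_N2 (n : ℕ) {γ : ℝ} (hγ : 0 ≤ γ) (f : Euc n → ℂ) :
    ∑' k : ℤ, ENNReal.ofReal (((2:ℝ) ^ k) ^ (2 * γ)) * ∫⁻ ξ in ann n ((2:ℝ) ^ k), ‖f ξ‖ₑ ^ 2
      ≤ ∫⁻ ξ, ENNReal.ofReal (‖ξ‖ ^ (2 * γ)) * ‖f ξ‖ₑ ^ 2 := by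
  calc _ ≤ ∑' k : ℤ, ∫⁻ ξ in ann n ((2:ℝ) ^ k), ENNReal.ofReal (‖ξ‖ ^ (2 * γ)) * ‖f ξ‖ₑ ^ 2 := by
        refine ENNReal.tsum_le_tsum fun k => ?_
        rw [← lintegral_const_mul' _ _ ENNReal.ofReal_ne_top]
        refine setLIntegral_mono' (ann_meas _ _) fun ξ hξ => ?_
        gcongr
        exact hξ.1
    _ = ∫⁻ ξ in ⋃ k : ℤ, ann n ((2:ℝ) ^ k), ENNReal.ofReal (‖ξ‖ ^ (2 * γ)) * ‖f ξ‖ₑ ^ 2 :=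
        (lintegral_iUnion (fun k : ℤ => ann_meas n ((2:ℝ) ^ k)) (ann_disj n) _).symm
    _ ≤ _ := setLIntegral_le_lintegral _ _


lemma Wt_rpow_le {δ q s : ℝ} (hq : 0 ≤ q) (hs : 0 < s) :
    Wt δ s ^ q ≤ 2 ^ q * (s ^ (q * δ) + s ^ (-(q * δ))) := by
  have p1 : 0 < s ^ δ := by positivity
  have p2 : 0 < s ^ (-δ) := by positivity
  have e1 : s ^ (q * δ) = (s ^ δ) ^ q := by rw [← Real.rpow_mul hs.le, mul_comm]
  have e2 : s ^ (-(q * δ)) = (s ^ (-δ)) ^ q := by rw [← Real.rpow_mul hs.le]; congr 1; ring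
  have p3 : 0 < (s ^ δ) ^ q := by positivity
  have p4 : 0 < (s ^ (-δ)) ^ q := by positivity
  rw [e1, e2]
  unfold Wt
  rcases le_total (s ^ δ) (s ^ (-δ)) with h | h
  · calc (s ^ δ + s ^ (-δ)) ^ q ≤ (2 * s ^ (-δ)) ^ q := by
          apply Real.rpow_le_rpow (by positivity) (by linarith) hq
      _ = 2 ^ q * (s ^ (-δ)) ^ q := Real.mul_rpow (by norm_num) p2.le
      _ ≤ _ := by gcongr; linarith
  · calc (s ^ δ + s ^ (-δ)) ^ q ≤ (2 * s ^ δ) ^ q := by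
          apply Real.rpow_le_rpow (by positivity) (by linarith) hq
      _ = 2 ^ q * (s ^ δ) ^ q := Real.mul_rpow (by norm_num) p1.le
      _ ≤ _ := by gcongr; linarith

lemma dyadic_W (n : ℕ) (hn : 2 ≤ n) (q γ δ : ℝ) (hq : 2 ≤ q)
    (h1 : 1/2 - 1/q < γ - δ) (h2 : γ + δ < (n : ℝ) / 2 - 1/q) (hδ : 0 < δ) : ∃ C : ℝ, 0 < C ∧
    ∀ L : ℝ, 0 < L → ∀ f : Euc n → ℂ, Integrable f →
    ∫⁻ t : ℝ, ∫⁻ r in Ioi (0:ℝ), ENNReal.ofReal (r ^ (q * ((n:ℝ)/2 - γ) - 2) * Wt δ (r * L) ^ q) * (A2 L f t r) ^ (q/2)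
      ≤ ENNReal.ofReal (C * L ^ (q * γ)) * (∫⁻ ξ in ann n L, ‖f ξ‖ₑ ^ 2) ^ (q/2) := by
  obtain ⟨C1, hC1, hS1⟩ := dyadic n hn q (γ - δ) hq h1 (by linarith)
  obtain ⟨C2, hC2, hS2⟩ := dyadic n hn q (γ + δ) hq (by linarith) h2
  refine ⟨2 ^ q * (C1 + C2), by positivity, ?_⟩
  intro L hL f hf
  set N := (∫⁻ ξ in ann n L, ‖f ξ‖ₑ ^ 2) ^ (q/2)
  have hm : ∀ E : ℝ, Measurable (fun p : ℝ × ℝ => ENNReal.ofReal (p.2 ^ E) * (A2 L f p.1 p.2) ^ (q/2)) := by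
    intro E
    refine Measurable.mul ?_ ((A2_meas L f hf).pow_const _)
    apply Measurable.ennreal_ofReal
    exact measurable_snd.pow_const _
  have hm1 : ∀ E t : ℝ, Measurable (fun r : ℝ => ENNReal.ofReal (r ^ E) * (A2 L f t r) ^ (q/2)) := by
    intro E t
    have := (hm E).comp (measurable_prodMk_left (x := t))
    exact this
  have hm2 : ∀ E : ℝ, Measurable (fun t : ℝ => ∫⁻ r in Ioi (0:ℝ), ENNReal.ofReal (r ^ E) * (A2 L f t r) ^ (q/2)) := by
    intro E
    exact (hm E).lintegral_prod_right' (ν := volume.restrict (Ioi (0:ℝ)))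
  set E1 := q * ((n:ℝ)/2 - (γ - δ)) - 2 with hE1
  set E2 := q * ((n:ℝ)/2 - (γ + δ)) - 2 with hE2
  set c1 : ℝ := 2 ^ q * L ^ (q * δ) with hc1
  set c2 : ℝ := 2 ^ q * L ^ (-(q * δ)) with hc2
  have hc10 : 0 ≤ c1 := by positivity
  have hc20 : 0 ≤ c2 := by positivity
  calc _ ≤ ∫⁻ t : ℝ, ∫⁻ r in Ioi (0:ℝ), (ENNReal.ofReal c1 * (ENNReal.ofReal (r ^ E1) * (A2 L f t r) ^ (q/2)) +
        ENNReal.ofReal c2 * (ENNReal.ofReal (r ^ E2) * (A2 L f t r) ^ (q/2))) := by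
        refine lintegral_mono fun t => setLIntegral_mono' measurableSet_Ioi fun r hr => ?_
        have hr0 : 0 < r := hr
        have hW := Wt_rpow_le (δ := δ) (q := q) (by linarith) (show 0 < r * L by positivity)
        rw [← mul_assoc, ← mul_assoc, ← ENNReal.ofReal_mul hc10, ← ENNReal.ofReal_mul hc20, ← add_mul,
          ← ENNReal.ofReal_add (by positivity) (by positivity)]
        refine mul_le_mul_left (ENNReal.ofReal_le_ofReal ?_) _
        have e1 : r ^ E1 = r ^ (q * ((n:ℝ)/2 - γ) - 2) * r ^ (q * δ) := by
          rw [← Real.rpow_add hr0]; congr 1; rw [hE1]; ring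
        have e2 : r ^ E2 = r ^ (q * ((n:ℝ)/2 - γ) - 2) * r ^ (-(q * δ)) := by
          rw [← Real.rpow_add hr0]; congr 1; rw [hE2]; ring
        rw [e1, e2, hc1, hc2]
        rw [Real.mul_rpow hr0.le hL.le, Real.mul_rpow hr0.le hL.le] at hW
        calc _ ≤ r ^ (q * ((n:ℝ)/2 - γ) - 2) * (2 ^ q * (r ^ (q * δ) * L ^ (q * δ) + r ^ (-(q * δ)) * L ^ (-(q * δ)))) := by
              gcongr
          _ = _ := by ring
    _ = ENNReal.ofReal c1 * (∫⁻ t : ℝ, ∫⁻ r in Ioi (0:ℝ), (ENNReal.ofReal (r ^ E1) * (A2 L f t r) ^ (q/2))) +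
        ENNReal.ofReal c2 * ∫⁻ t : ℝ, ∫⁻ r in Ioi (0:ℝ), (ENNReal.ofReal (r ^ E2) * (A2 L f t r) ^ (q/2)) := by
        rw [← lintegral_const_mul _ (hm2 E1), ← lintegral_const_mul _ (hm2 E2),
          ← lintegral_add_left ((hm2 E1).const_mul _)]
        refine lintegral_congr fun t => ?_
        rw [lintegral_add_left ((hm1 E1 t).const_mul _), lintegral_const_mul _ (hm1 E1 t), lintegral_const_mul _ (hm1 E2 t)]
    _ ≤ ENNReal.ofReal c1 * (ENNReal.ofReal (C1 * L ^ (q * (γ - δ))) * N) +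
        ENNReal.ofReal c2 * (ENNReal.ofReal (C2 * L ^ (q * (γ + δ))) * N) := by
        gcongr
        · exact hS1 L hL f hf
        · exact hS2 L hL f hf
    _ = _ := by
        rw [← mul_assoc, ← mul_assoc, ← ENNReal.ofReal_mul hc10, ← ENNReal.ofReal_mul hc20, ← add_mul,
          ← ENNReal.ofReal_add (by positivity) (by positivity)]
        congr 2
        have e1 : L ^ (q * γ) = L ^ (q * δ) * L ^ (q * (γ - δ)) := by
          rw [← Real.rpow_add hL]; congr 1; ring
        have e2 : L ^ (q * γ) = L ^ (-(q * δ)) * L ^ (q * (γ + δ)) := by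
          rw [← Real.rpow_add hL]; congr 1; ring
        have e3 : 2 ^ q * (C1 + C2) * L ^ (q * γ) = 2 ^ q * C1 * L ^ (q * γ) + 2 ^ q * C2 * L ^ (q * γ) := by ring
        rw [e3]
        nth_rewrite 1 [e1]
        rw [e2, hc1, hc2]; ring

/-- squared spherical norm of full wave -/
def AU {n : ℕ} (f : Euc n → ℂ) (t r : ℝ) : ℝ≥0∞ :=
  ∫⁻ ω : Metric.sphere (0 : Euc n) 1, ‖Uf f t (r • (ω : Euc n))‖ₑ ^ 2
    ∂((volume : Measure (Euc n)).toSphere)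

lemma AU_le (n : ℕ) (hn : 2 ≤ n) {δ : ℝ} (hδ : 0 < δ) : ∃ C : ℝ≥0∞, C ≠ ⊤ ∧ ∀ f : Euc n → ℂ, Integrable f →
    ∀ t r : ℝ, 0 < r →
    AU f t r ≤ C * ∑' k : ℤ, ENNReal.ofReal (Wt δ (r * 2 ^ k)) ^ 2 * A2 ((2:ℝ) ^ k) f t r := by
  obtain ⟨C, hC, hS⟩ := wsum hδ
  refine ⟨C, hC, fun f hf t r hr => ?_⟩
  have hmu : ∀ k : ℤ, Measurable (fun ω : Metric.sphere (0 : Euc n) 1 => ‖uk ((2:ℝ) ^ k) f t (r • (ω : Euc n))‖ₑ ^ 2) := by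
    intro k
    have hc : Continuous (fun ω : Metric.sphere (0 : Euc n) 1 => (t, r • (ω : Euc n))) := by fun_prop
    have := ((uk_cont ((2:ℝ) ^ k) f hf).comp hc).measurable.enorm.pow_const 2
    exact this
  have hpt : ∀ x : Euc n, ‖Uf f t x‖ₑ ^ 2 ≤ C * ∑' k : ℤ, ENNReal.ofReal (Wt δ (r * 2 ^ k)) ^ 2 * ‖uk ((2:ℝ) ^ k) f t x‖ₑ ^ 2 := by
    intro x
    calc ‖Uf f t x‖ₑ ^ 2 ≤ (∑' k : ℤ, ‖uk ((2:ℝ) ^ k) f t x‖ₑ) ^ 2 := by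
          gcongr; exact Uf_le n hn f hf t x
      _ = (∑' k : ℤ, ENNReal.ofReal ((Wt δ (r * 2 ^ k))⁻¹) * (ENNReal.ofReal (Wt δ (r * 2 ^ k)) * ‖uk ((2:ℝ) ^ k) f t x‖ₑ)) ^ 2 := by
          congr 2; ext k
          have hW := Wt_pos (δ := δ) (show 0 < r * 2 ^ k by positivity)
          rw [← mul_assoc, ← ENNReal.ofReal_mul (by positivity), inv_mul_cancel₀ hW.ne', ENNReal.ofReal_one, one_mul]
      _ ≤ _ := cs_tsum _ _
      _ ≤ C * ∑' k : ℤ, (ENNReal.ofReal (Wt δ (r * 2 ^ k)) * ‖uk ((2:ℝ) ^ k) f t x‖ₑ) ^ 2 :=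
          mul_le_mul_left (hS r hr) _
      _ = _ := by simp only [mul_pow]
  calc AU f t r ≤ ∫⁻ ω : Metric.sphere (0 : Euc n) 1, C * ∑' k : ℤ, ENNReal.ofReal (Wt δ (r * 2 ^ k)) ^ 2 * ‖uk ((2:ℝ) ^ k) f t (r • (ω : Euc n))‖ₑ ^ 2
    ∂((volume : Measure (Euc n)).toSphere) := lintegral_mono fun ω => hpt _
    _ = _ := by
        rw [lintegral_const_mul' _ _ hC, lintegral_tsum fun k => ((hmu k).const_mul _).aemeasurable]
        congr 2; ext k
        rw [lintegral_const_mul _ (hmu k)]; rfl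


lemma main_lint (n : ℕ) (hn : 2 ≤ n) (q γ : ℝ) (hq : 2 ≤ q)
    (h1 : 1/2 - 1/q < γ) (h2 : γ < (n : ℝ) / 2 - 1/q) : ∃ C : ℝ≥0∞, C ≠ ⊤ ∧
    ∀ f : Euc n → ℂ, Integrable f →
    (∫⁻ t : ℝ, ∫⁻ r in Ioi (0:ℝ), ENNReal.ofReal (r ^ (q * ((n:ℝ)/2 - γ) - 2)) * (AU f t r) ^ (q/2)) ^ (1/(q/2))
      ≤ C * ∫⁻ ξ, ENNReal.ofReal (‖ξ‖ ^ (2 * γ)) * ‖f ξ‖ₑ ^ 2 := by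
  have hq0 : 0 < q := by linarith
  have hγ : 0 ≤ γ := by
    have : 1/q ≤ 1/2 := one_div_le_one_div_of_le (by norm_num) hq
    linarith
  obtain ⟨δ, hδ, hδ1, hδ2⟩ : ∃ δ : ℝ, 0 < δ ∧ 1/2 - 1/q < γ - δ ∧ γ + δ < (n:ℝ)/2 - 1/q := by
    refine ⟨min (γ - (1/2 - 1/q)) ((n:ℝ)/2 - 1/q - γ) / 2, ?_, ?_, ?_⟩
    · have : 0 < min (γ - (1/2 - 1/q)) ((n:ℝ)/2 - 1/q - γ) := lt_min (by linarith) (by linarith)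
      linarith
    · have := min_le_left (γ - (1/2 - 1/q)) ((n:ℝ)/2 - 1/q - γ)
      linarith
    · have := min_le_right (γ - (1/2 - 1/q)) ((n:ℝ)/2 - 1/q - γ)
      linarith
  obtain ⟨C0, hC0, hS0⟩ := AU_le n hn hδ
  obtain ⟨C1, hC1, hS1⟩ := dyadic_W n hn q γ δ hq hδ1 hδ2 hδ
  refine ⟨C0 * ENNReal.ofReal (C1 ^ (2/q)), ENNReal.mul_ne_top hC0 ENNReal.ofReal_ne_top, ?_⟩
  intro f hf
  set E := q * ((n:ℝ)/2 - γ) - 2 with hE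
  have hp0 : 0 ≤ q/2 := by linarith
  set F : ℤ → ℝ × ℝ → ℝ≥0∞ := fun k p => C0 * ((ENNReal.ofReal (p.2 ^ (2*E/q)) * ENNReal.ofReal (Wt δ (p.2 * 2 ^ k)) ^ 2) *
    A2 ((2:ℝ) ^ k) f p.1 p.2) with hF
  have hFm : ∀ k, Measurable (F k) := by
    intro k
    refine Measurable.const_mul (Measurable.mul (Measurable.mul ?_ (Measurable.pow_const ?_ _)) (A2_meas _ f hf)) _
    · exact (measurable_snd.pow_const _).ennreal_ofReal
    · apply Measurable.ennreal_ofReal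
      unfold Wt
      have : Measurable fun p : ℝ × ℝ => p.2 * 2 ^ k := measurable_snd.mul_const _
      exact (this.pow_const _).add (this.pow_const _)
  have hFpt : ∀ k t, ∀ r ∈ Ioi (0:ℝ), F k (t, r) ^ (q/2) = C0 ^ (q/2) *
      (ENNReal.ofReal (r ^ E * Wt δ (r * 2 ^ k) ^ q) * A2 ((2:ℝ) ^ k) f t r ^ (q/2)) := by
    intro k t r hr
    have hr0 : 0 < r := hr
    have hW := Wt_pos (δ := δ) (show 0 < r * 2 ^ k by positivity)
    simp only [hF]
    rw [ENNReal.mul_rpow_of_nonneg _ _ hp0, ENNReal.mul_rpow_of_nonneg _ _ hp0, ← ENNReal.ofReal_pow hW.le,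
      ← ENNReal.ofReal_mul (by positivity), ENNReal.ofReal_rpow_of_nonneg (by positivity) hp0,
      Real.mul_rpow (by positivity) (by positivity), ← Real.rpow_mul hr0.le, ← Real.rpow_natCast, ← Real.rpow_mul hW.le]
    congr 5
    · field_simp
    · push_cast; ring
  set ν := (volume : Measure ℝ).prod (volume.restrict (Ioi (0:ℝ))) with hν
  have hk : ∀ k : ℤ, (∫⁻ p, F k p ^ (q/2) ∂ν) ^ (1/(q/2)) ≤ (C0 * ENNReal.ofReal (C1 ^ (2/q))) *
      (ENNReal.ofReal (((2:ℝ) ^ k) ^ (2 * γ)) * ∫⁻ ξ in ann n ((2:ℝ) ^ k), ‖f ξ‖ₑ ^ 2) := by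
    intro k
    set N2 := ∫⁻ ξ in ann n ((2:ℝ) ^ k), ‖f ξ‖ₑ ^ 2
    have hL : (0:ℝ) < 2 ^ k := by positivity
    have hb : ∫⁻ p, F k p ^ (q/2) ∂ν ≤ C0 ^ (q/2) * (ENNReal.ofReal (C1 * ((2:ℝ) ^ k) ^ (q * γ)) * N2 ^ (q/2)) := by
      rw [hν, lintegral_prod _ ((hFm k).pow_const _).aemeasurable]
      have hC0' : C0 ^ (q/2) ≠ ⊤ := ENNReal.rpow_ne_top_of_nonneg hp0 hC0
      calc _ = ∫⁻ t : ℝ, ∫⁻ r in Ioi (0:ℝ), C0 ^ (q/2) *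
            (ENNReal.ofReal (r ^ E * Wt δ (r * 2 ^ k) ^ q) * A2 ((2:ℝ) ^ k) f t r ^ (q/2)) :=
            lintegral_congr fun t => setLIntegral_congr_fun measurableSet_Ioi (hFpt k t)
        _ = C0 ^ (q/2) * ∫⁻ t : ℝ, ∫⁻ r in Ioi (0:ℝ), 
            (ENNReal.ofReal (r ^ E * Wt δ (r * 2 ^ k) ^ q) * A2 ((2:ℝ) ^ k) f t r ^ (q/2)) := by
            rw [← lintegral_const_mul' _ _ hC0']
            refine lintegral_congr fun t => ?_
            rw [lintegral_const_mul' _ _ hC0']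
        _ ≤ _ := by
            gcongr
            exact hS1 _ hL f hf
    have hinv : 0 ≤ 1/(q/2) := by positivity
    refine (ENNReal.rpow_le_rpow hb hinv).trans (le_of_eq ?_)
    have hqq : q/2 * (1/(q/2)) = 1 := by field_simp
    rw [ENNReal.mul_rpow_of_nonneg _ _ hinv, ENNReal.mul_rpow_of_nonneg _ _ hinv, ← ENNReal.rpow_mul, ← ENNReal.rpow_mul,
      hqq, ENNReal.rpow_one, ENNReal.rpow_one, ENNReal.ofReal_rpow_of_nonneg (by positivity) hinv,
      Real.mul_rpow hC1.le (by positivity), ← Real.rpow_mul hL.le, ENNReal.ofReal_mul (by positivity),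
      show q * γ * (1/(q/2)) = 2 * γ by field_simp, show 1/(q/2) = 2/q by field_simp]
    ring
  calc _ ≤ (∫⁻ p, (∑' k, F k p) ^ (q/2) ∂ν) ^ (1/(q/2)) := by
        refine ENNReal.rpow_le_rpow ?_ (by positivity)
        rw [hν, lintegral_prod _ ((Measurable.tsum hFm).pow_const _).aemeasurable]
        refine lintegral_mono fun t => setLIntegral_mono' measurableSet_Ioi fun r hr => ?_
        have hr0 : 0 < r := hr
        have e1 : ENNReal.ofReal (r ^ E) = ENNReal.ofReal (r ^ (2*E/q)) ^ (q/2) := by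
          rw [ENNReal.ofReal_rpow_of_nonneg (by positivity) hp0, ← Real.rpow_mul hr0.le]
          congr 2; field_simp
        rw [e1, ← ENNReal.mul_rpow_of_nonneg _ _ hp0]
        refine ENNReal.rpow_le_rpow ?_ hp0
        calc _ ≤ ENNReal.ofReal (r ^ (2*E/q)) * (C0 * ∑' k : ℤ, ENNReal.ofReal (Wt δ (r * 2 ^ k)) ^ 2 * A2 ((2:ℝ) ^ k) f t r) := by
              gcongr
              exact hS0 f hf t r hr0
          _ = _ := by
              rw [← ENNReal.tsum_mul_left, ← ENNReal.tsum_mul_left]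
              congr 1; ext k
              simp only [hF]; ring
    _ ≤ ∑' k, (∫⁻ p, F k p ^ (q/2) ∂ν) ^ (1/(q/2)) := mink_tsum_int ν (by linarith) F hFm
    _ ≤ ∑' k : ℤ, (C0 * ENNReal.ofReal (C1 ^ (2/q))) *
      (ENNReal.ofReal (((2:ℝ) ^ k) ^ (2 * γ)) * ∫⁻ ξ in ann n ((2:ℝ) ^ k), ‖f ξ‖ₑ ^ 2) := ENNReal.tsum_le_tsum hk
    _ ≤ _ := by
        rw [ENNReal.tsum_mul_left]
        gcongr
        exact sum_N2 n hγ f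


lemma sob_integrable (n : ℕ) {γ : ℝ} (hγ : 0 ≤ γ) (g : SchwartzMap (Euc n) ℂ) :
    Integrable (fun ξ : Euc n => ‖ξ‖ ^ (2 * γ) * ‖g ξ‖ ^ 2) := by
  set M := SchwartzMap.seminorm ℝ 0 0 g with hM
  have hb : ∀ ξ, ‖g ξ‖ ≤ M := fun ξ => SchwartzMap.norm_le_seminorm ℝ g ξ
  set m := ⌈2 * γ⌉₊
  have hi := ((SchwartzMap.integrable_pow_mul volume g 0).add (SchwartzMap.integrable_pow_mul volume g m)).const_mul M
  refine hi.mono' ?_ (Filter.Eventually.of_forall fun ξ => ?_)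
  · apply Measurable.aestronglyMeasurable
    exact (measurable_norm.pow_const _).mul (g.continuous.measurable.norm.pow_const _)
  · rw [Real.norm_of_nonneg (by positivity)]
    have h1 : ‖ξ‖ ^ (2 * γ) ≤ ‖ξ‖ ^ 0 + ‖ξ‖ ^ m := by
      rcases le_total ‖ξ‖ 1 with h | h
      · have : ‖ξ‖ ^ (2 * γ) ≤ 1 := Real.rpow_le_one (norm_nonneg _) h (by linarith)
        have h3 : 0 ≤ ‖ξ‖ ^ m := by positivity
        rw [pow_zero]; linarith
      · have : ‖ξ‖ ^ (2 * γ) ≤ ‖ξ‖ ^ m := by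
          rw [← Real.rpow_natCast]
          exact Real.rpow_le_rpow_of_exponent_le h (Nat.le_ceil _)
        rw [pow_zero]; linarith
    have hM0 : 0 ≤ M := (norm_nonneg _).trans (hb 0)
    simp only [Pi.add_apply]
    calc ‖ξ‖ ^ (2 * γ) * ‖g ξ‖ ^ 2 ≤ (‖ξ‖ ^ 0 + ‖ξ‖ ^ m) * (M * ‖g ξ‖) := by
          have := hb ξ
          rw [sq]
          gcongr
      _ = _ := by ring

theorem stmt8 (n : ℕ) (hn : 2 ≤ n) (q γ : ℝ) (hq : 2 ≤ q)
    (hγ1 : 1/2 - 1/q < γ) (hγ2 : γ < (n : ℝ) / 2 - 1/q) :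
    ∃ C > 0, ∀ φ : SchwartzMap (Euc n) ℂ,
      (∫ t in Ioi (0 : ℝ), ∫ r in Ioi (0 : ℝ),
          (r ^ ((n : ℝ) / 2 - ((n : ℝ) + 1) / q - γ) *
            sphL2 (halfWave t (fun y => φ y)) r) ^ q * r ^ ((n : ℝ) - 1)) ^ (1/q)
        ≤ C * hSob n γ (fun y => φ y) := by
  have hq0 : 0 < q := by linarith
  have hp0 : 0 ≤ q/2 := by linarith
  have hγ : 0 ≤ γ := by
    have : 1/q ≤ 1/2 := one_div_le_one_div_of_le (by norm_num) hq
    linarith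
  obtain ⟨C, hC, hS⟩ := main_lint n hn q γ hq hγ1 hγ2
  refine ⟨(C.toReal + 1) ^ (1/2:ℝ), by have := C.toReal_nonneg; positivity, fun φ => ?_⟩
  set g : SchwartzMap (Euc n) ℂ := 𝓕 φ with hg
  have hgf : (fun ξ => 𝓕 (fun y => φ y) ξ) = (g : Euc n → ℂ) := by
    rw [hg, SchwartzMap.fourier_coe]
  set f : Euc n → ℂ := fun ξ => 𝓕 (fun y => φ y) ξ with hf
  have hfi : Integrable f := by rw [hgf]; exact g.integrable
  have hU : ∀ t x, halfWave t (fun y => φ y) x = Uf f t x := fun t x => rfl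
  have hHi : Integrable (fun ξ : Euc n => ‖ξ‖ ^ (2 * γ) * ‖f ξ‖ ^ 2) := by
    rw [hgf]; exact sob_integrable n hγ g
  set H : ℝ := ∫ ξ : Euc n, ‖ξ‖ ^ (2 * γ) * ‖f ξ‖ ^ 2 with hH
  have hH0 : 0 ≤ H := integral_nonneg fun ξ => by positivity
  have hHS : hSob n γ (fun y => φ y) = H ^ (1/2:ℝ) := rfl
  have hHl : ∫⁻ ξ, ENNReal.ofReal (‖ξ‖ ^ (2 * γ)) * ‖f ξ‖ₑ ^ 2 = ENNReal.ofReal H := by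
    rw [hH, ofReal_integral_eq_lintegral_ofReal hHi (Filter.Eventually.of_forall fun ξ => by positivity)]
    refine lintegral_congr fun ξ => ?_
    rw [ENNReal.ofReal_mul (by positivity), ENNReal.ofReal_pow (norm_nonneg _), ofReal_norm]
  have hmain := hS f hfi
  rw [hHl] at hmain
  set G : ℝ → ℝ → ℝ := fun t r => (r ^ ((n : ℝ) / 2 - ((n : ℝ) + 1) / q - γ) *
            sphL2 (halfWave t (fun y => φ y)) r) ^ q * r ^ ((n : ℝ) - 1) with hG
  have hX0 : ∀ t r : ℝ, 0 ≤ ∫ ω : Metric.sphere (0 : Euc n) 1, ‖Uf f t (r • (ω : Euc n))‖ ^ 2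
      ∂((volume : Measure (Euc n)).toSphere) := fun t r => integral_nonneg fun ω => by positivity
  have hXle : ∀ t r : ℝ, ENNReal.ofReal (∫ ω : Metric.sphere (0 : Euc n) 1, ‖Uf f t (r • (ω : Euc n))‖ ^ 2
      ∂((volume : Measure (Euc n)).toSphere)) ≤ AU f t r := by
    intro t r
    rw [← Real.enorm_of_nonneg (hX0 t r)]
    refine (enorm_integral_le_lintegral_enorm _).trans (lintegral_mono fun ω => ?_)
    rw [enorm_pow, enorm_norm]
  have hGeq : ∀ t r : ℝ, 0 < r → G t r = r ^ (q * ((n:ℝ)/2 - γ) - 2) *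
      (∫ ω : Metric.sphere (0 : Euc n) 1, ‖Uf f t (r • (ω : Euc n))‖ ^ 2
      ∂((volume : Measure (Euc n)).toSphere)) ^ (q/2) := by
    intro t r hr
    have e : sphL2 (halfWave t (fun y => φ y)) r = (∫ ω : Metric.sphere (0 : Euc n) 1, ‖Uf f t (r • (ω : Euc n))‖ ^ 2
      ∂((volume : Measure (Euc n)).toSphere)) ^ (1/2:ℝ) := rfl
    have hx := hX0 t r
    simp only [hG]
    rw [e, Real.mul_rpow (by positivity) (by positivity), ← Real.rpow_mul hr.le, ← Real.rpow_mul hx,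
      mul_right_comm, ← Real.rpow_add hr]
    congr 2
    · field_simp; ring
    · ring
  have hG0 : ∀ t r : ℝ, 0 < r → 0 ≤ G t r := by
    intro t r hr
    rw [hGeq t r hr]
    have hx := hX0 t r
    positivity
  set I : ℝ := ∫ t in Ioi (0 : ℝ), ∫ r in Ioi (0 : ℝ), G t r with hI
  have hI0 : 0 ≤ I := integral_nonneg fun t => setIntegral_nonneg measurableSet_Ioi fun r hr => hG0 t r hr
  have hIle : ENNReal.ofReal I ≤ ∫⁻ t : ℝ, ∫⁻ r in Ioi (0:ℝ), ENNReal.ofReal (r ^ (q * ((n:ℝ)/2 - γ) - 2)) * (AU f t r) ^ (q/2) := by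
    rw [← Real.enorm_of_nonneg hI0, hI]
    refine (enorm_integral_le_lintegral_enorm _).trans ?_
    refine (setLIntegral_le_lintegral _ _).trans (lintegral_mono fun t => ?_)
    refine (enorm_integral_le_lintegral_enorm _).trans (setLIntegral_mono' measurableSet_Ioi fun r hr => ?_)
    have hr0 : 0 < r := hr
    rw [Real.enorm_of_nonneg (hG0 t r hr0), hGeq t r hr0, ENNReal.ofReal_mul (by positivity),
      ← ENNReal.ofReal_rpow_of_nonneg (hX0 t r) hp0]
    gcongr
    exact hXle t r
  have hinv : 0 ≤ 1/(q/2) := by positivity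
  have hfin : I ^ (1/(q/2)) ≤ C.toReal * H := by
    have h3 := (ENNReal.rpow_le_rpow hIle hinv).trans hmain
    rw [ENNReal.ofReal_rpow_of_nonneg hI0 hinv, ← ENNReal.ofReal_toReal hC, ← ENNReal.ofReal_mul ENNReal.toReal_nonneg,
      ENNReal.ofReal_le_ofReal_iff (by positivity)] at h3
    simpa using h3
  rw [hHS, ← Real.mul_rpow (by positivity) hH0]
  have e : I ^ (1/q) = (I ^ (1/(q/2))) ^ (1/2:ℝ) := by
    rw [← Real.rpow_mul hI0]; congr 1; field_simp
  rw [e]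
  refine Real.rpow_le_rpow (by positivity) (hfin.trans ?_) (by norm_num)
  have : C.toReal ≤ C.toReal + 1 := by linarith
  gcongr

end
end

section
/- (Dual trace embedding) For $n \ge 2$ and $1/2 < n/2 - (\gamma-1) < n/2$, i.e. $1-n/2 < \gamma - 1 < -1/2+1$, actually for $\gamma$ with $1/2 < 1-\gamma < n/2$: for all Schwartz $\varphi$ on $\mathbb{R}^n$, $\|\varphi\|_{\dot H^{\gamma-1}(\mathbb{R}^n)} \le C \left\| |x|^{-n/2 + 1 - \gamma} \varphi \right\|_{L^1_r L^2_\omega}$, where $\|h\|_{L^1_r L^2_\omega} = \int_0^\infty \left( \int_{S^{n-1}} |h(r\omega)|^2 d\sigma(\omega)\right)^{1/2} r^{n-1} dr$. -/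
open MeasureTheory Real Set FourierTransform
open scoped RealInnerProductSpace

noncomputable section

lemma flip_fourier {n : ℕ} {f g : Euc n → ℂ} (hf : Integrable f) (hg : Integrable g) :
    ∫ ξ, 𝓕 f ξ * g ξ = ∫ x, f x * 𝓕 g x := by
  simpa using! (VectorFourier.integral_fourierIntegral_smul_eq_flip (L := innerₗ (Euc n))
      Real.continuous_fourierChar continuous_inner hf hg)

lemma gauss_int {n : ℕ} {t : ℝ} (ht : 0 < t) (x : Euc n) :
    Integrable (fun v : Euc n => Complex.exp (-(π * t : ℝ) * ‖v‖ ^ 2 + 2 * π * Complex.I * ⟪x, v⟫)) := by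
  have := GaussianFourier.integrable_cexp_neg_mul_sq_norm_add (V := Euc n) (b := ((π * t : ℝ) : ℂ))
    (by rw [Complex.ofReal_re]; positivity) (2 * π * Complex.I) x
  simpa using this

lemma gauss_bound {n : ℕ} (φ : SchwartzMap (Euc n) ℂ) {t : ℝ} (ht : 0 < t) :
    ∫⁻ ξ : Euc n, ENNReal.ofReal (Real.exp (-(π * t) * ‖ξ‖ ^ 2) * ‖𝓕 (fun y => φ y) ξ‖ ^ 2)
      ≤ ∫⁻ x : Euc n, ∫⁻ y : Euc n, ‖φ x‖ₑ * (‖φ y‖ₑ *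
        ENNReal.ofReal (t ^ (-(n : ℝ) / 2) * Real.exp (-π * ‖x - y‖ ^ 2 / t))) := by
  have hφ : Integrable (fun y => φ y) := φ.integrable
  have hF : Integrable (𝓕 (fun y => φ y)) := by
    have := (𝓕 φ).integrable (μ := volume)
    rwa [SchwartzMap.fourier_coe] at this
  have hFc : Continuous (𝓕 (fun y => φ y)) := by
    have := (𝓕 φ).continuous
    rwa [SchwartzMap.fourier_coe] at this
  set F := 𝓕 (fun y => φ y) with hFdef
  let g : Euc n → ℂ := fun ξ => (Real.exp (-(π * t) * ‖ξ‖ ^ 2) : ℝ)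
  have hgc : Continuous g := by fun_prop
  have hgb : ∀ ξ, ‖g ξ‖ ≤ 1 := by
    intro ξ
    simp only [g, Complex.norm_real, Real.norm_eq_abs, Real.abs_exp]
    apply Real.exp_le_one_iff.2
    have : 0 ≤ π * t * ‖ξ‖ ^ 2 := by positivity
    linarith
  let h : Euc n → ℂ := fun ξ => g ξ * (starRingEnd ℂ) (F ξ)
  have hFconj : Integrable (fun ξ => (starRingEnd ℂ) (F ξ)) := by
    refine hF.congr' (by fun_prop) ?_
    filter_upwards with ξ
    simp
  have hh : Integrable h := hFconj.bdd_mul (c := 1) (by fun_prop) (by filter_upwards with ξ using hgb ξ)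
  have key := flip_fourier hφ hh
  have hpt : ∀ ξ, F ξ * h ξ = ((Real.exp (-(π * t) * ‖ξ‖ ^ 2) * ‖F ξ‖ ^ 2 : ℝ) : ℂ) := by
    intro ξ
    simp only [h, g]
    rw [mul_left_comm, Complex.mul_conj, Complex.normSq_eq_norm_sq]
    push_cast; rfl
  have hFb : ∃ C, ∀ ξ, ‖F ξ‖ ≤ C := by
    obtain ⟨C, hC⟩ := (𝓕 φ).decay 0 0
    refine ⟨C, fun ξ => ?_⟩
    have := hC.2 ξ
    simp only [pow_zero, norm_iteratedFDeriv_zero, one_mul] at this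
    rwa [SchwartzMap.fourier_coe] at this
  obtain ⟨C, hC⟩ := hFb
  have hint : Integrable (fun ξ => F ξ * h ξ) :=
    hh.bdd_mul (c := C) (by fun_prop) (by filter_upwards with ξ using hC ξ)
  have hint' : Integrable (fun ξ => Real.exp (-(π * t) * ‖ξ‖ ^ 2) * ‖F ξ‖ ^ 2) := by
    have := hint.re
    refine this.congr ?_
    filter_upwards with ξ
    rw [hpt]
    simp only [RCLike.re_to_complex, Complex.ofReal_re]
  rw [← ofReal_integral_eq_lintegral_ofReal hint' (by filter_upwards with ξ; positivity)]
  have e1 : ENNReal.ofReal (∫ ξ, Real.exp (-(π * t) * ‖ξ‖ ^ 2) * ‖F ξ‖ ^ 2)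
      = ‖∫ ξ, F ξ * h ξ‖ₑ := by
    simp_rw [hpt]
    rw [integral_complex_ofReal, ← ofReal_norm, Complex.norm_real, Real.norm_of_nonneg]
    exact integral_nonneg (fun ξ => by positivity)
  rw [e1, key]
  refine (enorm_integral_le_lintegral_enorm _).trans ?_
  refine lintegral_mono fun x => ?_
  rw [enorm_mul, lintegral_const_mul' _ _ enorm_ne_top]
  gcongr
  have e2 : 𝓕 h x = (starRingEnd ℂ) (∫ v, F v *
      Complex.exp (-(π * t : ℝ) * ‖v‖ ^ 2 + 2 * π * Complex.I * ⟪x, v⟫)) := by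
    rw [Real.fourier_eq', ← integral_conj]
    congr 1
    ext v
    simp only [h, g, smul_eq_mul, map_mul, ← Complex.exp_conj, map_pow, map_neg,
      Complex.conj_ofReal, Complex.conj_I, Complex.exp_add, Complex.ofReal_exp]
    rw [real_inner_comm]
    have : (starRingEnd ℂ) 2 = 2 := Complex.conj_ofReal 2
    rw [this]
    push_cast
    ring_nf
  rw [e2, hFdef, flip_fourier hφ (gauss_int ht x), RCLike.enorm_conj]
  refine (enorm_integral_le_lintegral_enorm _).trans ?_
  refine lintegral_mono fun y => ?_
  rw [enorm_mul]
  gcongr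
  rw [fourier_gaussian_innerProductSpace' (by rw [Complex.ofReal_re]; positivity),
    ← ofReal_norm]
  apply ENNReal.ofReal_le_ofReal
  apply le_of_eq
  have hpi := Real.pi_pos
  have e3 : (π : ℂ) / ((π * t : ℝ) : ℂ) = ((t⁻¹ : ℝ) : ℂ) := by
    rw [← Complex.ofReal_div]; congr 1; field_simp
  have e4 : -(π : ℂ) ^ 2 * (‖x - y‖ : ℂ) ^ 2 / ((π * t : ℝ) : ℂ) = ((-π * ‖x - y‖ ^ 2 / t : ℝ) : ℂ) := by
    norm_cast
    field_simp
  rw [e3, e4, ← Complex.ofReal_exp, norm_mul, Complex.norm_real, Real.norm_eq_abs, Real.abs_exp]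
  congr 1
  rw [Complex.norm_cpow_eq_rpow_re_of_pos (by positivity), Real.inv_rpow ht.le, ← Real.rpow_neg ht.le]
  congr 1
  simp
  ring

lemma L2 {s : ℝ} (hs : 0 < s) : ∃ C : ENNReal, C ≠ ⊤ ∧ ∀ x : ℝ, 0 ≤ x →
    ENNReal.ofReal (x ^ (-(2 * s))) ≤ C * ∫⁻ t in Ioi (0:ℝ), ENNReal.ofReal (t ^ (s - 1) *
      Real.exp (-(π * t) * x ^ 2)) := by
  have hG := Real.Gamma_pos_of_pos hs
  refine ⟨ENNReal.ofReal (π ^ s / Real.Gamma s), ENNReal.ofReal_ne_top, fun x hx => ?_⟩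
  rcases hx.eq_or_lt with rfl | hx
  · rw [Real.zero_rpow (by linarith)]; simp
  have hr : 0 < π * x ^ 2 := by positivity
  have key := integral_rpow_mul_exp_neg_mul_Ioi hs hr
  have hint : IntegrableOn (fun t : ℝ ↦ t ^ (s - 1) * rexp (-(π * x ^ 2 * t))) (Ioi 0) :=
    .of_integral_ne_zero (by rw [key]; positivity)
  have : ∀ t : ℝ, -(π * t) * x ^ 2 = -(π * x ^ 2 * t) := fun t => by ring
  simp_rw [this]
  rw [← ofReal_integral_eq_lintegral_ofReal hint, key, ← ENNReal.ofReal_mul (by positivity)]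
  · apply ENNReal.ofReal_le_ofReal
    apply le_of_eq
    rw [one_div, Real.inv_rpow hr.le, Real.mul_rpow (by positivity) (by positivity),
      ← Real.rpow_natCast x 2, ← Real.rpow_mul hx.le, Real.rpow_neg hx.le]
    push_cast
    field_simp
  · filter_upwards [ae_restrict_mem measurableSet_Ioi] with t ht
    have : (0:ℝ) < t := ht
    positivity

lemma L3 {a : ℝ} (ha : 0 < a) : ∃ C : ENNReal, C ≠ ⊤ ∧ ∀ z : ENNReal, z ≠ ⊤ →
    ∫⁻ t in Ioi (0:ℝ), ENNReal.ofReal (t ^ (- a / 2 - 1) *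
      Real.exp (-π * z.toReal ^ 2 / t)) ≤ C * z ^ (-a) := by
  have hG := Real.Gamma_pos_of_pos (half_pos ha)
  refine ⟨ENNReal.ofReal (π ^ (- a / 2) * Real.Gamma (a / 2)), ENNReal.ofReal_ne_top, fun z hz => ?_⟩
  rcases eq_or_ne z 0 with rfl | hz0
  · rw [ENNReal.zero_rpow_of_neg (by linarith), ENNReal.mul_top]
    · exact le_top
    · simp only [ne_eq, ENNReal.ofReal_eq_zero, not_le]; positivity
  lift z to NNReal using hz
  have hx : 0 < (z : ℝ) := by
    have : z ≠ 0 := by simpa using hz0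
    positivity
  rw [ENNReal.coe_toReal, ← ENNReal.coe_rpow_of_ne_zero (by simpa using hz0),
    ← ENNReal.ofReal_coe_nnreal, NNReal.coe_rpow]
  generalize (z : ℝ) = x at hx
  have hr : 0 < π * x ^ 2 := by positivity
  have key := integral_rpow_mul_exp_neg_mul_Ioi (half_pos ha) hr
  have hne : (1 / (π * x ^ 2)) ^ (a / 2) * Real.Gamma (a / 2) ≠ 0 := by positivity
  rw [← integral_comp_rpow_Ioi _ (show (-1:ℝ) ≠ 0 by norm_num)] at key
  have e : ∀ t ∈ Ioi (0:ℝ), (|(-1:ℝ)| * t ^ ((-1:ℝ) - 1)) • ((t ^ (-1:ℝ)) ^ (a / 2 - 1) *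
      rexp (-(π * x ^ 2 * t ^ (-1:ℝ)))) = t ^ (- a / 2 - 1) * Real.exp (-π * x ^ 2 / t) := by
    intro t ht
    have ht : (0:ℝ) < t := ht
    rw [abs_neg, abs_one, one_mul, smul_eq_mul, ← mul_assoc, ← Real.rpow_mul ht.le,
      ← Real.rpow_add ht, Real.rpow_neg_one]
    congr 2 <;> ring
  rw [setIntegral_congr_fun measurableSet_Ioi e] at key
  have hint : IntegrableOn (fun t : ℝ ↦ t ^ (- a / 2 - 1) * Real.exp (-π * x ^ 2 / t)) (Ioi 0) :=
    .of_integral_ne_zero (by rw [key]; exact hne)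
  rw [← ofReal_integral_eq_lintegral_ofReal hint, key, ← ENNReal.ofReal_mul (by positivity)]
  · apply ENNReal.ofReal_le_ofReal
    apply le_of_eq
    rw [one_div, Real.inv_rpow hr.le, Real.mul_rpow (by positivity) (by positivity),
      ← Real.rpow_natCast x 2, ← Real.rpow_mul hx.le, Real.rpow_neg hx.le, neg_div, Real.rpow_neg pi_pos.le]
    push_cast
    rw [mul_div_cancel₀ _ (by norm_num : (2:ℝ) ≠ 0)]
    field_simp
  · filter_upwards [ae_restrict_mem measurableSet_Ioi] with t ht
    have : (0:ℝ) < t := ht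
    positivity

lemma polar {n : ℕ} (hn : 2 ≤ n) (f : Euc n → ENNReal) (hf : Measurable f) :
    ∫⁻ x, f x = ∫⁻ r in Ioi (0:ℝ), ENNReal.ofReal (r ^ (n - 1)) *
      ∫⁻ ω : Metric.sphere (0 : Euc n) 1, f (r • (ω : Euc n)) ∂(volume : Measure (Euc n)).toSphere := by
  have : Nontrivial (Euc n) := by
    have : Nonempty (Fin n) := ⟨⟨0, by omega⟩⟩
    infer_instance
  calc ∫⁻ x, f x = ∫⁻ x : ({(0)}ᶜ : Set (Euc n)), f x ∂(Measure.comap Subtype.val volume) := by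
        rw [lintegral_subtype_comap (measurableSet_singleton _).compl f, restrict_compl_singleton]
    _ = ∫⁻ p, f ((p.2 : ℝ) • (p.1 : Euc n)) ∂((volume : Measure (Euc n)).toSphere.prod
          (.volumeIoiPow (Module.finrank ℝ (Euc n) - 1))) := by
        rw [← (volume : Measure (Euc n)).measurePreserving_homeomorphUnitSphereProd.lintegral_comp_emb
          (Homeomorph.measurableEmbedding _)]
        refine lintegral_congr fun x => ?_
        have := congrArg Subtype.val ((homeomorphUnitSphereProd (Euc n)).symm_apply_apply x)
        rw [homeomorphUnitSphereProd_symm_apply_coe] at this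
        rw [this]
    _ = _ := by
        have hm : Measurable fun p : Metric.sphere (0 : Euc n) 1 × Ioi (0:ℝ) =>
            f ((p.2 : ℝ) • (p.1 : Euc n)) := by fun_prop
        rw [lintegral_prod_symm _ hm.aemeasurable, Measure.volumeIoiPow,
          lintegral_withDensity_eq_lintegral_mul _ (by fun_prop)]
        · simp only [Pi.mul_apply, finrank_euclideanSpace_fin]
          rw [lintegral_subtype_comap measurableSet_Ioi (fun r : ℝ => ENNReal.ofReal (r ^ (n - 1)) *
            ∫⁻ ω : Metric.sphere (0 : Euc n) 1, f (r • (ω : Euc n))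
              ∂(volume : Measure (Euc n)).toSphere)]
        · exact hm.lintegral_prod_left'

lemma h_integrable {c : ℝ} (hc : c < 1) :
    Integrable ((Metric.ball (0:ℝ) 2).indicator (fun t : ℝ => |t| ^ (-c))) := by
  rw [integrable_indicator_iff Metric.isOpen_ball.measurableSet]
  have := (integrableOn_fun_norm_addHaar (E := ℝ) (volume : Measure ℝ) (f := fun y : ℝ => y ^ (-c))
    (r := 2)).2
  simp only [Module.finrank_self, Nat.sub_self, pow_zero, one_smul, Real.norm_eq_abs] at this
  apply this
  have h2 := (intervalIntegral.intervalIntegrable_rpow' (a := 0) (b := 2) (r := -c) (by linarith)).1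
  exact h2.mono_set Ioo_subset_Ioc_self

lemma cone_bound {n : ℕ} (hn : 2 ≤ n) {a : ℝ} (ha : 0 < a) (ha' : a < (n:ℝ) - 1) :
    ∃ B : ENNReal, B ≠ ⊤ ∧ ∀ ω : Metric.sphere (0 : Euc n) 1,
      ∫⁻ x in Metric.ball (0 : Euc n) 1, ‖(ω : Euc n) - ‖x‖⁻¹ • x‖ₑ ^ (-a) ≤ B := by
  classical
  have hn1 : (0:ℝ) < (n:ℝ) - 1 := ha.trans ha'
  set c : ℝ := a / ((n:ℝ) - 1) with hcdef
  have hc0 : 0 < c := by positivity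
  have hc1 : c < 1 := (div_lt_one hn1).2 ha'
  let i0 : Fin n := ⟨0, by omega⟩
  let h : Fin n → ℝ → ℝ := fun i => (Metric.ball (0:ℝ) 2).indicator
    (fun t => |t| ^ (-(if i = i0 then 0 else c)))
  have hint : ∀ i, Integrable (h i) := by
    intro i
    apply h_integrable
    split_ifs <;> linarith
  have hm : ∀ i, Measurable (h i) := by
    intro i
    apply Measurable.indicator _ Metric.isOpen_ball.measurableSet
    fun_prop
  have hprod : Integrable (fun y : Fin n → ℝ => ∏ i, h i (y i)) := Integrable.fintype_prod hint
  refine ⟨_, hprod.lintegral_lt_top.ne, fun ω => ?_⟩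
  have hω : ‖(ω : Euc n)‖ = 1 := by simpa using ω.2
  obtain ⟨b, hb⟩ := Orthonormal.exists_orthonormalBasis_extension_of_card_eq (𝕜 := ℝ) (E := Euc n)
    (ι := Fin n) (by simp) (v := fun _ => (ω : Euc n)) (s := {i0}) (by
      constructor
      · intro i; exact hω
      · intro i j hij
        exact absurd (Subsingleton.elim i j) hij)
  have hb0 : b i0 = ω := hb i0 rfl
  have hmp : MeasurePreserving (fun x : Euc n => (WithLp.ofLp (b.repr x) : Fin n → ℝ)) :=
    (PiLp.volume_preserving_ofLp (Fin n)).comp b.measurePreserving_repr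
  rw [← hmp.lintegral_comp (f := fun y : Fin n → ℝ => ENNReal.ofReal (∏ i, h i (y i))) (by fun_prop),
    ← lintegral_indicator Metric.isOpen_ball.measurableSet]
  have hae : ∀ᵐ y : Fin n → ℝ, ∀ i, y i ≠ 0 := by
    rw [ae_all_iff]
    intro i
    have : ∀ᵐ t : ℝ, t ≠ 0 := by simp [ae_iff]
    exact (Measure.quasiMeasurePreserving_eval (fun _ : Fin n => (volume : Measure ℝ)) i).ae this
  apply lintegral_mono_ae
  filter_upwards [hmp.quasiMeasurePreserving.ae hae] with x hx
  by_cases hxb : x ∈ Metric.ball (0 : Euc n) 1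
  swap
  · rw [indicator_of_notMem hxb]; exact zero_le
  rw [indicator_of_mem hxb]
  have hx1 : ‖x‖ < 1 := by simpa using hxb
  have hcoord : ∀ i, |b.repr x i| ≤ ‖x‖ := by
    intro i
    rw [b.repr_apply_apply]
    simpa using abs_real_inner_le_norm (b i) x
  have hh : ∀ i, h i (b.repr x i) = |b.repr x i| ^ (-(if i = i0 then 0 else c)) := by
    intro i
    apply indicator_of_mem
    rw [mem_ball_zero_iff, Real.norm_eq_abs]
    linarith [hcoord i]
  simp only [hh]
  rw [← Finset.mul_prod_erase _ _ (Finset.mem_univ i0), if_pos rfl, neg_zero, Real.rpow_zero, one_mul,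
    ENNReal.ofReal_prod_of_nonneg (fun i _ => by positivity)]
  set u : Euc n := ‖x‖⁻¹ • x with hu
  have hxu : x = ‖x‖ • u := by
    rcases eq_or_ne x 0 with h0 | h0
    · simp [h0]
    · rw [hu, smul_smul, mul_inv_cancel₀ (norm_ne_zero_iff.2 h0), one_smul]
  have hle : ∀ i, i ≠ i0 → |b.repr x i| ≤ ‖(ω : Euc n) - u‖ := by
    intro i hi
    have h1 : ⟪b i, (ω : Euc n) - u⟫ = - ⟪b i, u⟫ := by
      rw [inner_sub_right, ← hb0, b.inner_eq_zero hi, zero_sub]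
    have h2 : |⟪b i, u⟫| ≤ ‖(ω : Euc n) - u‖ := by
      rw [← abs_neg, ← h1]
      simpa using abs_real_inner_le_norm (b i) ((ω : Euc n) - u)
    rw [b.repr_apply_apply]
    have h3 : ⟪b i, x⟫ = ‖x‖ * ⟪b i, u⟫ := by
      conv_lhs => rw [hxu]
      rw [inner_smul_right]
    rw [h3, abs_mul, abs_norm]
    calc ‖x‖ * |⟪b i, u⟫| ≤ 1 * |⟪b i, u⟫| := by gcongr
      _ ≤ _ := by rw [one_mul]; exact h2
  have hcard : (Finset.univ.erase i0).card = n - 1 := by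
    rw [Finset.card_erase_of_mem (Finset.mem_univ _), Finset.card_univ, Fintype.card_fin]
  calc ‖(ω : Euc n) - u‖ₑ ^ (-a) = ∏ i ∈ Finset.univ.erase i0, ‖(ω : Euc n) - u‖ₑ ^ (-c) := by
        rw [Finset.prod_const, hcard, ← ENNReal.rpow_natCast, ← ENNReal.rpow_mul]
        congr 1
        rw [Nat.cast_sub (by omega), hcdef]
        push_cast
        field_simp
    _ ≤ _ := by
        apply Finset.prod_le_prod' 
        intro i hi
        have hi' : i ≠ i0 := Finset.ne_of_mem_erase hi
        rw [if_neg hi']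
        have hpos : 0 < |b.repr x i| := abs_pos.2 (hx i)
        rw [← ENNReal.ofReal_rpow_of_pos hpos, ENNReal.rpow_neg, ENNReal.rpow_neg, ENNReal.inv_le_inv]
        apply ENNReal.rpow_le_rpow _ hc0.le
        rw [← ofReal_norm]
        exact ENNReal.ofReal_le_ofReal (hle i hi')

lemma sphere_bound {n : ℕ} (hn : 2 ≤ n) {a : ℝ} (ha : 0 < a) (ha' : a < (n:ℝ) - 1) :
    ∃ A : ENNReal, A ≠ ⊤ ∧ ∀ ω : Metric.sphere (0 : Euc n) 1,
      ∫⁻ θ : Metric.sphere (0 : Euc n) 1, ‖(ω : Euc n) - θ‖ₑ ^ (-a)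
        ∂(volume : Measure (Euc n)).toSphere ≤ A := by
  obtain ⟨B, hB, hB'⟩ := cone_bound hn ha ha'
  set k : ENNReal := ENNReal.ofReal ((1/2) ^ (n - 1)) * ENNReal.ofReal (1/2) with hk
  have hk0 : k ≠ 0 := by
    apply mul_ne_zero <;> simp only [ne_eq, ENNReal.ofReal_eq_zero, not_le] <;> positivity
  have hkt : k ≠ ⊤ := ENNReal.mul_ne_top ENNReal.ofReal_ne_top ENNReal.ofReal_ne_top
  refine ⟨B / k, ENNReal.div_ne_top hB hk0, fun ω => ?_⟩
  rw [ENNReal.le_div_iff_mul_le (Or.inl hk0) (Or.inl hkt)]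
  refine le_trans ?_ (hB' ω)
  rw [← lintegral_indicator Metric.isOpen_ball.measurableSet, polar hn]
  swap
  · apply Measurable.indicator _ Metric.isOpen_ball.measurableSet
    fun_prop
  set S := ∫⁻ θ : Metric.sphere (0 : Euc n) 1, ‖(ω : Euc n) - θ‖ₑ ^ (-a)
        ∂(volume : Measure (Euc n)).toSphere with hS
  calc S * k = ∫⁻ r in Ioo (1/2 : ℝ) 1, ENNReal.ofReal ((1/2) ^ (n - 1)) * S := by
        rw [setLIntegral_const, Real.volume_Ioo, hk]
        norm_num
        ring
    _ ≤ ∫⁻ r in Ioo (1/2 : ℝ) 1, ENNReal.ofReal (r ^ (n - 1)) *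
      ∫⁻ θ : Metric.sphere (0 : Euc n) 1, (Metric.ball (0 : Euc n) 1).indicator
        (fun x => ‖(ω : Euc n) - ‖x‖⁻¹ • x‖ₑ ^ (-a)) (r • (θ : Euc n))
          ∂(volume : Measure (Euc n)).toSphere := by
        apply setLIntegral_mono' measurableSet_Ioo
        intro r hr
        have hr0 : 0 < r := lt_trans (by norm_num) hr.1
        gcongr
        · exact hr.1.le
        · rw [hS]
          apply lintegral_mono
          intro θ
          have hθ : ‖(θ : Euc n)‖ = 1 := by simpa using θ.2
          have hn : ‖r • (θ : Euc n)‖ = r := by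
            rw [norm_smul, hθ, mul_one, Real.norm_of_nonneg hr0.le]
          simp only
          rw [indicator_of_mem (by rw [mem_ball_zero_iff, hn]; exact hr.2), hn, smul_smul,
            inv_mul_cancel₀ hr0.ne', one_smul]
    _ ≤ _ := lintegral_mono_set (fun r hr => lt_trans (by norm_num) hr.1)

lemma energy_bound {n : ℕ} {s : ℝ} (hs : 0 < s) (hs' : s < (n : ℝ) / 2) :
    ∃ C : ENNReal, C ≠ ⊤ ∧ ∀ φ : SchwartzMap (Euc n) ℂ,
      ∫⁻ ξ : Euc n, ENNReal.ofReal (‖ξ‖ ^ (-(2 * s)) * ‖𝓕 (fun y => φ y) ξ‖ ^ 2)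
        ≤ C * ∫⁻ x : Euc n, ∫⁻ y : Euc n, ‖φ x‖ₑ * ‖φ y‖ₑ * ‖x - y‖ₑ ^ (-((n : ℝ) - 2 * s)) := by
  obtain ⟨C1, hC1, h1⟩ := L2 hs
  obtain ⟨C2, hC2, h2⟩ := L3 (a := (n : ℝ) - 2 * s) (by linarith)
  refine ⟨C1 * C2, ENNReal.mul_ne_top hC1 hC2, fun φ => ?_⟩
  have hFc : Continuous (𝓕 (fun y => φ y)) := by
    have := (𝓕 φ).continuous
    rwa [SchwartzMap.fourier_coe] at this
  set F := 𝓕 (fun y => φ y) with hF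
  calc ∫⁻ ξ : Euc n, ENNReal.ofReal (‖ξ‖ ^ (-(2 * s)) * ‖F ξ‖ ^ 2)
      ≤ ∫⁻ ξ : Euc n, C1 * ∫⁻ t in Ioi (0:ℝ), ENNReal.ofReal (t ^ (s - 1)) *
          ENNReal.ofReal (Real.exp (-(π * t) * ‖ξ‖ ^ 2) * ‖F ξ‖ ^ 2) := by
        refine lintegral_mono fun ξ => ?_
        rw [ENNReal.ofReal_mul (by positivity)]
        refine (mul_le_mul_left (h1 ‖ξ‖ (norm_nonneg _)) _).trans ?_
        rw [mul_assoc, ← lintegral_mul_const' _ _ ENNReal.ofReal_ne_top]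
        gcongr C1 * ?_
        apply setLIntegral_mono' measurableSet_Ioi
        intro t ht
        have ht : (0:ℝ) < t := ht
        rw [← ENNReal.ofReal_mul (by positivity), ← ENNReal.ofReal_mul (by positivity), mul_assoc]
    _ = C1 * ∫⁻ t in Ioi (0:ℝ), ∫⁻ ξ : Euc n, ENNReal.ofReal (t ^ (s - 1)) *
          ENNReal.ofReal (Real.exp (-(π * t) * ‖ξ‖ ^ 2) * ‖F ξ‖ ^ 2) := by
        rw [lintegral_const_mul' _ _ hC1, lintegral_lintegral_swap]
        apply Measurable.aemeasurable
        have := hFc.measurable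
        fun_prop
    _ ≤ C1 * ∫⁻ t in Ioi (0:ℝ), ∫⁻ x : Euc n, ∫⁻ y : Euc n, ‖φ x‖ₑ * ‖φ y‖ₑ *
          ENNReal.ofReal (t ^ (-((n : ℝ) - 2 * s) / 2 - 1) * Real.exp (-π * ‖x - y‖ ^ 2 / t)) := by
        gcongr C1 * ?_
        apply setLIntegral_mono' measurableSet_Ioi
        intro t ht
        have ht : (0:ℝ) < t := ht
        rw [lintegral_const_mul' _ _ ENNReal.ofReal_ne_top]
        refine (mul_le_mul_right (gauss_bound φ ht) _).trans ?_
        rw [← lintegral_const_mul' _ _ ENNReal.ofReal_ne_top]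
        refine lintegral_mono fun x => ?_
        simp only
        rw [← lintegral_const_mul' _ _ ENNReal.ofReal_ne_top]
        refine lintegral_mono fun y => le_of_eq ?_
        simp only
        have e : t ^ (-((n : ℝ) - 2 * s) / 2 - 1) = t ^ (s - 1) * t ^ (-(n:ℝ) / 2) := by
          rw [← Real.rpow_add ht]; congr 1; ring
        rw [e, mul_assoc (t ^ (s-1)), ENNReal.ofReal_mul (p := t ^ (s-1)) (by positivity)]
        ring
    _ = C1 * ∫⁻ x : Euc n, ∫⁻ y : Euc n, ∫⁻ t in Ioi (0:ℝ), ‖φ x‖ₑ * ‖φ y‖ₑ *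
          ENNReal.ofReal (t ^ (-((n : ℝ) - 2 * s) / 2 - 1) * Real.exp (-π * ‖x - y‖ ^ 2 / t)) := by
        have hφ := φ.continuous.measurable
        congr 1
        rw [lintegral_lintegral_swap]
        · refine lintegral_congr fun x => ?_
          rw [lintegral_lintegral_swap]
          apply Measurable.aemeasurable
          fun_prop
        · apply Measurable.aemeasurable
          exact Measurable.lintegral_prod_right' (f := fun q : (ℝ × Euc n) × Euc n =>
            ‖φ q.1.2‖ₑ * ‖φ q.2‖ₑ *
          ENNReal.ofReal (q.1.1 ^ (-((n : ℝ) - 2 * s) / 2 - 1) *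
            Real.exp (-π * ‖q.1.2 - q.2‖ ^ 2 / q.1.1))) (by fun_prop)
    _ ≤ C1 * ∫⁻ x : Euc n, ∫⁻ y : Euc n, C2 * (‖φ x‖ₑ * ‖φ y‖ₑ *
          ‖x - y‖ₑ ^ (-((n : ℝ) - 2 * s))) := by
        gcongr C1 * ?_
        refine lintegral_mono fun x => lintegral_mono fun y => ?_
        simp only
        rw [lintegral_const_mul' _ _ (ENNReal.mul_ne_top enorm_ne_top enorm_ne_top),
          mul_left_comm C2]
        gcongr
        have := h2 ‖x - y‖ₑ enorm_ne_top
        simpa only [toReal_enorm] using this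
    _ = _ := by
        rw [mul_assoc]
        congr 1
        rw [← lintegral_const_mul' _ _ hC2]
        refine lintegral_congr fun x => ?_
        rw [lintegral_const_mul' _ _ hC2]

lemma schur {X : Type*} [MeasurableSpace X] (μ : Measure X) [SFinite μ] (k : X → X → ENNReal)
    (hk : Measurable (Function.uncurry k)) (A : ENNReal) (h1 : ∀ x, ∫⁻ y, k x y ∂μ ≤ A)
    (h2 : ∀ y, ∫⁻ x, k x y ∂μ ≤ A) (f g : X → ENNReal) (hf : Measurable f) (hg : Measurable g) :
    ∫⁻ x, ∫⁻ y, f x * g y * k x y ∂μ ∂μ ≤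
      A * ((∫⁻ x, f x ^ 2 ∂μ) ^ (1/2 : ℝ) * (∫⁻ x, g x ^ 2 ∂μ) ^ (1/2 : ℝ)) := by
  have hk' : Measurable fun p : X × X => k p.1 p.2 := hk
  have hsq : ∀ z : ENNReal, (z ^ (1/2 : ℝ)) ^ (2:ℝ) = z := fun z => by
    rw [← ENNReal.rpow_mul]; norm_num
  have e1 : ∫⁻ x, ∫⁻ y, f x * g y * k x y ∂μ ∂μ
      = ∫⁻ p, (f p.1 * k p.1 p.2 ^ (1/2:ℝ)) * (g p.2 * k p.1 p.2 ^ (1/2:ℝ)) ∂(μ.prod μ) := by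
    rw [lintegral_prod _ (by fun_prop)]
    refine lintegral_congr fun x => lintegral_congr fun y => ?_
    have : k x y = k x y ^ (1/2:ℝ) * k x y ^ (1/2:ℝ) := by
      rw [← sq, ← ENNReal.rpow_two, hsq]
    conv_lhs => rw [this]
    ring
  rw [e1]
  have hol := ENNReal.lintegral_mul_le_Lp_mul_Lq (μ.prod μ) Real.HolderConjugate.two_two
    (f := fun p => f p.1 * k p.1 p.2 ^ (1/2:ℝ)) (g := fun p => g p.2 * k p.1 p.2 ^ (1/2:ℝ))
    (by fun_prop) (by fun_prop)
  refine hol.trans ?_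
  have b1 : ∫⁻ p, (f p.1 * k p.1 p.2 ^ (1/2:ℝ)) ^ (2:ℝ) ∂(μ.prod μ) ≤ A * ∫⁻ x, f x ^ 2 ∂μ := by
    rw [lintegral_prod _ (by fun_prop), ← lintegral_const_mul _ (by fun_prop)]
    refine lintegral_mono fun x => ?_
    simp only [ENNReal.mul_rpow_of_nonneg _ _ (zero_le_two : (0:ℝ) ≤ 2), hsq, ENNReal.rpow_two]
    rw [lintegral_const_mul _ (by fun_prop), mul_comm]
    gcongr
    exact h1 x
  have b2 : ∫⁻ p, (g p.2 * k p.1 p.2 ^ (1/2:ℝ)) ^ (2:ℝ) ∂(μ.prod μ) ≤ A * ∫⁻ x, g x ^ 2 ∂μ := by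
    rw [lintegral_prod_symm _ (by fun_prop), ← lintegral_const_mul _ (by fun_prop)]
    refine lintegral_mono fun x => ?_
    simp only [ENNReal.mul_rpow_of_nonneg _ _ (zero_le_two : (0:ℝ) ≤ 2), hsq, ENNReal.rpow_two]
    rw [lintegral_const_mul _ (by fun_prop), mul_comm]
    gcongr
    exact h2 x
  calc _ ≤ (A * ∫⁻ x, f x ^ 2 ∂μ) ^ (1/2:ℝ) * (A * ∫⁻ x, g x ^ 2 ∂μ) ^ (1/2:ℝ) := by
        gcongr
    _ = _ := by
        rw [ENNReal.mul_rpow_of_nonneg _ _ (by norm_num), ENNReal.mul_rpow_of_nonneg _ _ (by norm_num)]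
        have : A = A ^ (1/2:ℝ) * A ^ (1/2:ℝ) := by
          rw [← sq, ← ENNReal.rpow_two, hsq]
        conv_rhs => rw [this]
        ring

lemma kernel_bound {n : ℕ} {a : ℝ} (ha : 0 < a) {r ρ : ℝ} (hr : 0 < r) (hρ : 0 < ρ)
    (ω θ : Euc n) (hω : ‖ω‖ = 1) (hθ : ‖θ‖ = 1) :
    ‖r • ω - ρ • θ‖ₑ ^ (-a) ≤ ENNReal.ofReal (r ^ (-a/2)) * ENNReal.ofReal (ρ ^ (-a/2)) *
      ‖ω - θ‖ₑ ^ (-a) := by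
  have h1 : (r * ρ) * ‖ω - θ‖ ^ 2 ≤ ‖r • ω - ρ • θ‖ ^ 2 := by
    rw [norm_sub_sq_real, norm_sub_sq_real, norm_smul, norm_smul, real_inner_smul_left,
      real_inner_smul_right, hω, hθ, Real.norm_of_nonneg hr.le, Real.norm_of_nonneg hρ.le]
    nlinarith [sq_nonneg (r - ρ)]
  have h2 : ENNReal.ofReal (r * ρ) * ‖ω - θ‖ₑ ^ (2:ℝ) ≤ ‖r • ω - ρ • θ‖ₑ ^ (2:ℝ) := by
    rw [ENNReal.rpow_two, ENNReal.rpow_two, ← ofReal_norm, ← ofReal_norm,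
      ← ENNReal.ofReal_pow (norm_nonneg _), ← ENNReal.ofReal_pow (norm_nonneg _),
      ← ENNReal.ofReal_mul (by positivity)]
    exact ENNReal.ofReal_le_ofReal h1
  have h3 := ENNReal.rpow_le_rpow h2 (show 0 ≤ a / 2 by positivity)
  rw [ENNReal.mul_rpow_of_nonneg _ _ (by positivity), ← ENNReal.rpow_mul, ← ENNReal.rpow_mul,
    mul_div_cancel₀ _ (by norm_num : (2:ℝ) ≠ 0), ENNReal.ofReal_rpow_of_pos (by positivity)] at h3
  have h4 := ENNReal.inv_le_inv.2 h3
  have hp : 0 < (r * ρ) ^ (a / 2) := by positivity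
  rw [ENNReal.mul_inv (Or.inl (by simpa using hp)) (Or.inl ENNReal.ofReal_ne_top),
    ← ENNReal.rpow_neg, ← ENNReal.rpow_neg, ← ENNReal.ofReal_inv_of_pos hp,
    ← Real.rpow_neg (by positivity), Real.mul_rpow hr.le hρ.le,
    ENNReal.ofReal_mul (by positivity), ← neg_div] at h4
  exact h4

lemma polar_energy {n : ℕ} (hn : 2 ≤ n) {a : ℝ} (ha : 0 < a) (ha' : a < (n:ℝ) - 1) :
    ∃ A : ENNReal, A ≠ ⊤ ∧ ∀ φ : Euc n → ℂ, Continuous φ →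
      ∫⁻ x : Euc n, ∫⁻ y : Euc n, ‖φ x‖ₑ * ‖φ y‖ₑ * ‖x - y‖ₑ ^ (-a) ≤
      A * (∫⁻ r in Ioi (0:ℝ), ENNReal.ofReal (r ^ (n - 1)) * (ENNReal.ofReal (r ^ (-a/2)) *
        (∫⁻ ω : Metric.sphere (0 : Euc n) 1, ‖φ (r • (ω : Euc n))‖ₑ ^ 2
          ∂(volume : Measure (Euc n)).toSphere) ^ (1/2:ℝ))) ^ 2 := by
  obtain ⟨A, hA, hA'⟩ := sphere_bound hn ha ha'
  refine ⟨A, hA, fun φ hφ => ?_⟩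
  have hφm := hφ.measurable
  set σ := (volume : Measure (Euc n)).toSphere with hσ
  set Φ : ℝ → ENNReal := fun r => (∫⁻ ω : Metric.sphere (0 : Euc n) 1, ‖φ (r • (ω : Euc n))‖ₑ ^ 2
          ∂σ) ^ (1/2:ℝ) with hΦ
  have hΦm : Measurable Φ := by
    apply Measurable.pow_const
    exact Measurable.lintegral_prod_right' (f := fun q : ℝ × Metric.sphere (0 : Euc n) 1 =>
      ‖φ (q.1 • (q.2 : Euc n))‖ₑ ^ 2) (by fun_prop)
  set w : ℝ → ENNReal := fun r => ENNReal.ofReal (r ^ (n - 1)) * (ENNReal.ofReal (r ^ (-a/2)) * Φ r)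
    with hw
  have hwm : Measurable w := by fun_prop
  rw [polar hn _ (Measurable.lintegral_prod_right' (f := fun q : Euc n × Euc n =>
      ‖φ q.1‖ₑ * ‖φ q.2‖ₑ * ‖q.1 - q.2‖ₑ ^ (-a)) (by fun_prop))]
  calc _ = ∫⁻ r in Ioi (0:ℝ), ENNReal.ofReal (r ^ (n - 1)) *
        ∫⁻ ω : Metric.sphere (0 : Euc n) 1, (∫⁻ ρ in Ioi (0:ℝ), ENNReal.ofReal (ρ ^ (n - 1)) *
        ∫⁻ θ : Metric.sphere (0 : Euc n) 1, ‖φ (r • (ω : Euc n))‖ₑ * ‖φ (ρ • (θ : Euc n))‖ₑ *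
          ‖r • (ω : Euc n) - ρ • (θ : Euc n)‖ₑ ^ (-a) ∂σ) ∂σ := by
        refine lintegral_congr fun r => ?_
        congr 1
        refine lintegral_congr fun ω => ?_
        rw [polar hn _ (by fun_prop)]
    _ = ∫⁻ r in Ioi (0:ℝ), ENNReal.ofReal (r ^ (n - 1)) *
        ∫⁻ ρ in Ioi (0:ℝ), ENNReal.ofReal (ρ ^ (n - 1)) *
        ∫⁻ ω : Metric.sphere (0 : Euc n) 1,
        ∫⁻ θ : Metric.sphere (0 : Euc n) 1, ‖φ (r • (ω : Euc n))‖ₑ * ‖φ (ρ • (θ : Euc n))‖ₑ *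
          ‖r • (ω : Euc n) - ρ • (θ : Euc n)‖ₑ ^ (-a) ∂σ ∂σ := by
        refine lintegral_congr fun r => ?_
        congr 1
        rw [lintegral_lintegral_swap]
        · refine lintegral_congr fun ρ => ?_
          rw [lintegral_const_mul' _ _ ENNReal.ofReal_ne_top]
        · apply Measurable.aemeasurable
          apply Measurable.mul (by fun_prop)
          exact Measurable.lintegral_prod_right'
            (f := fun q : (Metric.sphere (0 : Euc n) 1 × ℝ) × Metric.sphere (0 : Euc n) 1 =>
            ‖φ (r • (q.1.1 : Euc n))‖ₑ * ‖φ (q.1.2 • (q.2 : Euc n))‖ₑ *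
          ‖r • (q.1.1 : Euc n) - q.1.2 • (q.2 : Euc n)‖ₑ ^ (-a)) (by fun_prop)
    _ ≤ ∫⁻ r in Ioi (0:ℝ), ENNReal.ofReal (r ^ (n - 1)) *
        ∫⁻ ρ in Ioi (0:ℝ), ENNReal.ofReal (ρ ^ (n - 1)) *
        (ENNReal.ofReal (r ^ (-a/2)) * ENNReal.ofReal (ρ ^ (-a/2)) * (A * (Φ r * Φ ρ))) := by
        apply setLIntegral_mono' measurableSet_Ioi
        intro r hr
        gcongr ENNReal.ofReal (r ^ (n - 1)) * ?_
        apply setLIntegral_mono' measurableSet_Ioi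
        intro ρ hρ
        gcongr ENNReal.ofReal (ρ ^ (n - 1)) * ?_
        have hsc := schur σ (fun ω θ => ‖(ω : Euc n) - θ‖ₑ ^ (-a))
          (by unfold Function.uncurry; fun_prop) A hA'
          (fun θ => by
            refine le_trans (le_of_eq ?_) (hA' θ)
            refine lintegral_congr fun ω => ?_
            rw [enorm_sub_rev]) (fun ω => ‖φ (r • (ω : Euc n))‖ₑ)
            (fun ω => ‖φ (ρ • (ω : Euc n))‖ₑ) (by fun_prop) (by fun_prop)
        refine le_trans ?_ (mul_le_mul_right hsc _)
        rw [← lintegral_const_mul' _ _ (ENNReal.mul_ne_top ENNReal.ofReal_ne_top ENNReal.ofReal_ne_top)]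
        refine lintegral_mono fun ω => ?_
        simp only
        rw [← lintegral_const_mul' _ _ (ENNReal.mul_ne_top ENNReal.ofReal_ne_top ENNReal.ofReal_ne_top)]
        refine lintegral_mono fun θ => ?_
        simp only
        rw [mul_left_comm]
        gcongr
        exact kernel_bound ha hr hρ _ _ (by simp) (by simp)
    _ = ∫⁻ r in Ioi (0:ℝ), (A * w r) * ∫⁻ ρ in Ioi (0:ℝ), w ρ := by
        refine lintegral_congr fun r => ?_
        rw [← lintegral_const_mul _ (by fun_prop), ← lintegral_const_mul _ hwm]
        refine lintegral_congr fun ρ => ?_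
        simp only [hw]
        ring
    _ = _ := by
        rw [lintegral_mul_const _ (by fun_prop), lintegral_const_mul _ hwm]
        ring

lemma ofReal_sphL2 {n : ℕ} (φ : Euc n → ℂ) (hφ : Continuous φ) (r : ℝ) :
    ENNReal.ofReal (sphL2 φ r) = (∫⁻ ω : Metric.sphere (0 : Euc n) 1, ‖φ (r • (ω : Euc n))‖ₑ ^ 2
          ∂(volume : Measure (Euc n)).toSphere) ^ (1/2:ℝ) := by
  have hc : Continuous fun ω : Metric.sphere (0 : Euc n) 1 => ‖φ (r • (ω : Euc n))‖ ^ 2 := by fun_prop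
  rw [sphL2, ← ENNReal.ofReal_rpow_of_nonneg (integral_nonneg fun _ => by positivity) (by norm_num),
    ofReal_integral_eq_lintegral_ofReal (hc.integrable_of_hasCompactSupport
      (HasCompactSupport.of_compactSpace _)) (by filter_upwards with x; positivity)]
  congr 1
  refine lintegral_congr fun ω => ?_
  rw [ENNReal.ofReal_pow (norm_nonneg _), ofReal_norm]

lemma sphL2_nonneg {n : ℕ} (φ : Euc n → ℂ) (r : ℝ) : 0 ≤ sphL2 φ r :=
  Real.rpow_nonneg (integral_nonneg fun _ => by positivity) _

lemma sphL2_meas {n : ℕ} (φ : Euc n → ℂ) (hφ : Continuous φ) : Measurable (sphL2 φ) := by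
  apply Measurable.pow_const
  have : StronglyMeasurable fun r : ℝ => ∫ ω : Metric.sphere (0 : Euc n) 1, ‖φ (r • (ω : Euc n))‖ ^ 2
      ∂(volume : Measure (Euc n)).toSphere :=
    StronglyMeasurable.integral_prod_right' (f := fun q : ℝ × Metric.sphere (0 : Euc n) 1 =>
      ‖φ (q.1 • (q.2 : Euc n))‖ ^ 2) (Continuous.stronglyMeasurable (by fun_prop))
  exact this.measurable

lemma sphL2_le {n : ℕ} (φ : Euc n → ℂ) (r D : ℝ) (hD : 0 ≤ D)
    (h : ∀ ω : Metric.sphere (0 : Euc n) 1, ‖φ (r • (ω : Euc n))‖ ≤ D) :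
    sphL2 φ r ≤ D * ((volume : Measure (Euc n)).toSphere.real univ) ^ (1/2 : ℝ) := by
  have h1 : ∫ ω : Metric.sphere (0 : Euc n) 1, ‖φ (r • (ω : Euc n))‖ ^ 2
      ∂(volume : Measure (Euc n)).toSphere ≤ D ^ 2 * (volume : Measure (Euc n)).toSphere.real univ := by
    refine (integral_mono_of_nonneg (g := fun _ => D ^ 2) (by filter_upwards with x; positivity)
      (integrable_const _) ?_).trans ?_
    · filter_upwards with ω
      have := h ω
      gcongr
    · rw [integral_const, smul_eq_mul, mul_comm]
  refine (Real.rpow_le_rpow (integral_nonneg fun _ => by positivity) h1 (by norm_num)).trans ?_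
  rw [Real.mul_rpow (by positivity) (by positivity), ← Real.rpow_natCast D 2, ← Real.rpow_mul hD]
  norm_num

lemma rad_int {n : ℕ} (hn : 2 ≤ n) {e : ℝ} (he : -(n:ℝ) / 2 < e) (he' : e < 0)
    (φ : SchwartzMap (Euc n) ℂ) :
    IntegrableOn (fun r : ℝ => r ^ e * sphL2 (fun y => φ y) r * r ^ ((n : ℝ) - 1)) (Ioi 0) := by
  have hn' : (2:ℝ) ≤ n := by exact_mod_cast hn
  have hm : Measurable (fun r : ℝ => r ^ e * sphL2 (fun y => φ y) r * r ^ ((n : ℝ) - 1)) := by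
    have := sphL2_meas (fun y => φ y) φ.continuous
    fun_prop
  set M := ((volume : Measure (Euc n)).toSphere.real univ) ^ (1/2 : ℝ) with hM
  have hM0 : 0 ≤ M := by positivity
  rw [← Ioc_union_Ioi_eq_Ioi (zero_le_one (α := ℝ))]
  apply IntegrableOn.union
  · obtain ⟨C, hC0, hC⟩ := φ.decay 0 0
    have hb := (intervalIntegral.intervalIntegrable_rpow' (a := 0) (b := 1)
      (r := e + ((n:ℝ) - 1)) (by linarith)).1
    refine Integrable.mono' (hb.const_mul (C * M)) hm.aestronglyMeasurable ?_
    filter_upwards [ae_restrict_mem measurableSet_Ioc] with r hr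
    have hr0 : 0 < r := hr.1
    have h0 := sphL2_nonneg (fun y => φ y) r
    have h1 := sphL2_le (fun y => φ y) r C hC0.le (fun ω => by simpa using hC (r • (ω : Euc n)))
    rw [Real.norm_of_nonneg (by positivity), Real.rpow_add hr0]
    calc _ ≤ r ^ e * (C * M) * r ^ ((n:ℝ) - 1) := by gcongr
      _ = _ := by ring
  · obtain ⟨C, hC0, hC⟩ := φ.decay (n + 1) 0
    have hb := integrableOn_Ioi_rpow_of_lt (a := -2) (by norm_num) (zero_lt_one)
    refine Integrable.mono' (hb.const_mul (C * M)) hm.aestronglyMeasurable ?_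
    filter_upwards [ae_restrict_mem measurableSet_Ioi] with r hr
    have hr1 : 1 < r := hr
    have hr0 : 0 < r := by linarith
    have h0 := sphL2_nonneg (fun y => φ y) r
    have h1 := sphL2_le (fun y => φ y) r (C * r ^ (-((n:ℝ) + 1))) (by positivity) (fun ω => by
      have := hC (r • (ω : Euc n))
      rw [norm_smul, norm_eq_of_mem_sphere, mul_one, Real.norm_of_nonneg hr0.le,
        norm_iteratedFDeriv_zero] at this
      rw [Real.rpow_neg hr0.le, ← div_eq_mul_inv, le_div_iff₀ (by positivity), mul_comm]
      exact_mod_cast this)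
    rw [Real.norm_of_nonneg (by positivity)]
    calc _ ≤ r ^ e * ((C * r ^ (-((n:ℝ) + 1))) * M) * r ^ ((n:ℝ) - 1) := by gcongr
      _ = (C * M) * (r ^ e * r ^ (-((n:ℝ) + 1)) * r ^ ((n:ℝ) - 1)) := by ring
      _ = (C * M) * (r ^ (e - 2)) := by
        rw [← Real.rpow_add hr0, ← Real.rpow_add hr0]; congr 2; ring
      _ ≤ _ := by
        gcongr
        · exact hr1.le
        · linarith

/-- (Dual trace embedding) For `n ≥ 2` and `γ` with `1/2 < 1-γ < n/2` there is `C`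
so that for all Schwartz `φ`,
`‖φ‖_{Ḣ^{γ-1}} ≤ C ‖ |x|^{-n/2+1-γ} φ ‖_{L¹_r L²_ω}`, where
`‖h‖_{L¹_r L²_ω} = ∫₀^∞ ‖h(r·)‖_{L²(S^{n-1})} r^{n-1} dr`. -/
theorem stmt9 (n : ℕ) (hn : 2 ≤ n) (γ : ℝ)
    (hγ1 : 1/2 < 1 - γ) (hγ2 : 1 - γ < (n : ℝ) / 2) :
    ∃ C > 0, ∀ φ : SchwartzMap (Euc n) ℂ,
      hSob n (γ - 1) (fun y => φ y)
        ≤ C * ∫ r in Ioi (0 : ℝ),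
            r ^ (-(n : ℝ) / 2 + 1 - γ) * sphL2 (fun y => φ y) r * r ^ ((n : ℝ) - 1) := by
  obtain ⟨C1, hC1, h1⟩ := energy_bound (n := n) (s := 1 - γ) (by linarith) hγ2
  obtain ⟨A, hA, h2⟩ := polar_energy hn (a := (n:ℝ) - 2 * (1 - γ)) (by linarith) (by linarith)
  set K := (C1 * A).toReal with hK
  refine ⟨K ^ (1/2 : ℝ) + 1, by positivity, fun φ => ?_⟩
  have hn' : (2:ℝ) ≤ n := by exact_mod_cast hn
  have hint := rad_int hn (e := -(n : ℝ) / 2 + 1 - γ) (by linarith) (by linarith) φ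
  set J := ∫ r in Ioi (0 : ℝ),
            r ^ (-(n : ℝ) / 2 + 1 - γ) * sphL2 (fun y => φ y) r * r ^ ((n : ℝ) - 1) with hJ
  have hJae : 0 ≤ᵐ[volume.restrict (Ioi (0:ℝ))] fun r : ℝ =>
      r ^ (-(n : ℝ) / 2 + 1 - γ) * sphL2 (fun y => φ y) r * r ^ ((n : ℝ) - 1) := by
    filter_upwards [ae_restrict_mem measurableSet_Ioi] with r hr
    have hr : (0:ℝ) < r := hr
    have h0 := sphL2_nonneg (fun y => φ y) r
    positivity
  have hJ0 : 0 ≤ J := integral_nonneg_of_ae hJae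
  have hJe : ∫⁻ r in Ioi (0:ℝ), ENNReal.ofReal (r ^ (n - 1)) *
      (ENNReal.ofReal (r ^ (-((n:ℝ) - 2 * (1 - γ))/2)) *
        (∫⁻ ω : Metric.sphere (0 : Euc n) 1, ‖φ (r • (ω : Euc n))‖ₑ ^ 2
          ∂(volume : Measure (Euc n)).toSphere) ^ (1/2:ℝ)) = ENNReal.ofReal J := by
    rw [hJ, ofReal_integral_eq_lintegral_ofReal hint hJae]
    refine setLIntegral_congr_fun measurableSet_Ioi fun r hr => ?_
    have hr : (0:ℝ) < r := hr
    have h0 := sphL2_nonneg (fun y => φ y) r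
    have e1 : r ^ ((n:ℝ) - 1) = r ^ (n - 1) := by
      rw [← Real.rpow_natCast, Nat.cast_sub (by omega), Nat.cast_one]
    have e2 : -((n:ℝ) - 2 * (1 - γ))/2 = -(n : ℝ) / 2 + 1 - γ := by ring
    rw [← ofReal_sphL2 (fun y => φ y) φ.continuous r, e1, e2,
      ENNReal.ofReal_mul (by positivity), ENNReal.ofReal_mul (by positivity)]
    ring
  have hFc : Continuous (𝓕 (fun y => φ y)) := by
    have := (𝓕 φ).continuous
    rwa [SchwartzMap.fourier_coe] at this
  have hmain := (h1 φ).trans (mul_le_mul_right (h2 (fun y => φ y) φ.continuous) _)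
  rw [hJe, ← mul_assoc] at hmain
  have hreal : ∫ ξ : Euc n, ‖ξ‖ ^ (2 * (γ - 1)) * ‖𝓕 (fun y => φ y) ξ‖ ^ 2 ≤ K * J ^ 2 := by
    rw [integral_eq_lintegral_of_nonneg_ae (by filter_upwards with ξ; positivity)
      (by
        apply Measurable.aestronglyMeasurable
        have := hFc.measurable
        fun_prop)]
    have e : 2 * (γ - 1) = -(2 * (1 - γ)) := by ring
    rw [e]
    have hfin : C1 * A * ENNReal.ofReal J ^ 2 ≠ ⊤ :=
      ENNReal.mul_ne_top (ENNReal.mul_ne_top hC1 hA) (ENNReal.pow_ne_top ENNReal.ofReal_ne_top)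
    refine (ENNReal.toReal_mono hfin hmain).trans (le_of_eq ?_)
    rw [ENNReal.toReal_mul, ENNReal.toReal_pow, ENNReal.toReal_ofReal hJ0]
  rw [hSob]
  refine (Real.rpow_le_rpow (integral_nonneg fun ξ => by positivity) hreal (by norm_num)).trans ?_
  have hK0 : 0 ≤ K := ENNReal.toReal_nonneg
  rw [Real.mul_rpow hK0 (by positivity), ← Real.rpow_natCast J 2, ← Real.rpow_mul hJ0]
  norm_num
  nlinarith

end
end
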